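/- For every PCTSP instance and every feasible solution (x,y) of the PCTSP LP relaxation, there exists a tour whose value (tour cost plus penalties of unvisited vertices) is at most ((1+√5)/2) · (Σ_{e∈E} c_e x_e + Σ_{v∈V} π_v (1 − y_v)), where (1+√5)/2 ≈ 1.618 is the golden ratio. -/

import Mathlib

/-- The edge set of the complete graph on `V`: all 2-element subsets of `V`. -/
def completeEdges (V : Type*) [Fintype V] [DecidableEq V] : Finset (Finset V) :=
  Finset.univ.powersetCard 2

/-- The cut `δ(S)`: edges of the complete graph with exactly one endpoint in `S`. -/
def cutEdges (V : Type*) [Fintype V] [DecidableEq V] (S : Finset V) : Finset (Finset V) :=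
  (completeEdges V).filter (fun e => (e ∩ S).card = 1)

/-- Feasibility for the PCTSP LP relaxation. -/
def IsFeasibleLP {V : Type*} [Fintype V] [DecidableEq V]
    (r : V) (x : Finset V → ℝ) (y : V → ℝ) : Prop :=
  (∀ e ∈ completeEdges V, 0 ≤ x e) ∧ (∀ v : V, 0 ≤ y v) ∧ y r = 1 ∧
  (∀ v : V, v ≠ r → ∑ e ∈ cutEdges V {v}, x e = 2 * y v) ∧
  (∑ e ∈ cutEdges V {r}, x e ≤ 2) ∧
  (∀ S : Finset V, r ∉ S → ∀ v ∈ S, 2 * y v ≤ ∑ e ∈ cutEdges V S, x e)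

/-- The cost of a tour given as a list of (distinct) vertices: the sum of the costs of
consecutive edges, plus the closing edge back to the start if the tour has at least two
vertices. -/
def tourCost {V : Type*} [DecidableEq V] (c : Finset V → ℝ) (t : List V) : ℝ :=
  if t.length ≤ 1 then 0
  else ((t.zip (t.rotate 1)).map (fun p => c {p.1, p.2})).sum

/-- The total weight of the pairs leaving `S`. -/
def cutVal {V : Type*} [Fintype V] [DecidableEq V] (x : V → V → ℝ) (S : Finset V) : ℝ :=
  ∑ a ∈ S, ∑ b ∈ Sᶜ, x a b

set_option linter.unusedSectionVars false

section CutFunction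

variable {V : Type*} [Fintype V] [DecidableEq V] {x : V → V → ℝ}

theorem cutVal_compl (hs : ∀ a b, x a b = x b a) (S : Finset V) :
    cutVal x Sᶜ = cutVal x S := by
  unfold cutVal
  rw [Finset.sum_comm, compl_compl]
  exact Finset.sum_congr rfl fun a _ => Finset.sum_congr rfl fun b _ => hs _ _

theorem cutVal_eq_sum_ite (S : Finset V) :
    cutVal x S = ∑ a, ∑ b, if a ∈ S ∧ b ∉ S then x a b else 0 := by
  unfold cutVal
  rw [← Finset.sum_filter_add_sum_filter_not Finset.univ (fun a => a ∈ S)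
    (fun a => ∑ b, if a ∈ S ∧ b ∉ S then x a b else 0)]
  have h2 : ∑ a with a ∉ S, ∑ b, (if a ∈ S ∧ b ∉ S then x a b else 0) = 0 := by
    refine Finset.sum_eq_zero fun a ha => Finset.sum_eq_zero fun b _ => ?_
    simp only [Finset.mem_filter, Finset.mem_univ, true_and] at ha
    simp [ha]
  rw [h2, add_zero]
  refine Finset.sum_congr (by ext; simp) fun a ha => ?_
  rw [← Finset.sum_filter_add_sum_filter_not Finset.univ (fun b => b ∈ S)]
  have h3 : ∑ b with b ∈ S, (if a ∈ S ∧ b ∉ S then x a b else 0) = 0 :=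
    Finset.sum_eq_zero fun b hb => by
      simp only [Finset.mem_filter, Finset.mem_univ, true_and] at hb
      simp [hb]
  rw [h3, zero_add]
  refine Finset.sum_congr (by ext; simp) fun b hb => ?_
  have ha' : a ∈ S := by simpa using ha
  have hb' : b ∉ S := by simpa using hb
  simp [ha', hb']

theorem two_mul_cutVal (hs : ∀ a b, x a b = x b a) (S : Finset V) :
    2 * cutVal x S = ∑ a, ∑ b, if (a ∈ S ↔ b ∈ S) then 0 else x a b := by
  have h1 := cutVal_eq_sum_ite (x := x) S
  have h2 : cutVal x S = ∑ a, ∑ b, if b ∈ S ∧ a ∉ S then x a b else 0 := by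
    rw [h1, Finset.sum_comm]
    refine Finset.sum_congr rfl fun a _ => Finset.sum_congr rfl fun b _ => ?_
    rw [hs]
  rw [two_mul]
  nth_rw 1 [h1]
  rw [h2, ← Finset.sum_add_distrib]
  refine Finset.sum_congr rfl fun a _ => ?_
  rw [← Finset.sum_add_distrib]
  refine Finset.sum_congr rfl fun b _ => ?_
  by_cases ha : a ∈ S <;> by_cases hb : b ∈ S <;> simp [ha, hb]

theorem cutVal_nonneg (h0 : ∀ a b, 0 ≤ x a b) (S : Finset V) : 0 ≤ cutVal x S :=
  Finset.sum_nonneg fun _ _ => Finset.sum_nonneg fun _ _ => h0 _ _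

theorem cutVal_singleton (v : V) : cutVal x {v} = ∑ b ∈ {v}ᶜ, x v b := by
  simp [cutVal]

theorem le_cutVal (h0 : ∀ a b, 0 ≤ x a b) {S : Finset V} {a b : V} (ha : a ∈ S) (hb : b ∉ S) :
    x a b ≤ cutVal x S := by
  unfold cutVal
  refine le_trans ?_ (Finset.single_le_sum (f := fun a => ∑ b ∈ Sᶜ, x a b)
    (fun _ _ => Finset.sum_nonneg fun _ _ => h0 _ _) ha)
  exact Finset.single_le_sum (f := fun b => x a b) (fun _ _ => h0 _ _) (by simpa using hb)

theorem cutVal_inter_add_union (hs : ∀ a b, x a b = x b a) (h0 : ∀ a b, 0 ≤ x a b)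
    (A B : Finset V) :
    cutVal x (A ∩ B) + cutVal x (A ∪ B) ≤ cutVal x A + cutVal x B := by
  have key : 2 * cutVal x (A ∩ B) + 2 * cutVal x (A ∪ B) ≤ 2 * cutVal x A + 2 * cutVal x B := by
    simp only [two_mul_cutVal hs, ← Finset.sum_add_distrib]
    refine Finset.sum_le_sum fun a _ => Finset.sum_le_sum fun b _ => ?_
    have := h0 a b
    by_cases h1 : a ∈ A <;> by_cases h2 : a ∈ B <;> by_cases h3 : b ∈ A <;> by_cases h4 : b ∈ B <;>
      simp [h1, h2, h3, h4] <;> linarith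
  linarith

theorem cutVal_sdiff_add_sdiff (hs : ∀ a b, x a b = x b a) (h0 : ∀ a b, 0 ≤ x a b)
    (A B : Finset V) {u v : V} (huA : u ∈ A) (huB : u ∈ B) (hvA : v ∉ A) (hvB : v ∉ B) :
    cutVal x (A \ B) + cutVal x (B \ A) + x u v ≤ cutVal x A + cutVal x B := by
  have e : 2 * x u v = ∑ a, ∑ b, if a = u ∧ b = v then 2 * x a b else 0 := by
    rw [Finset.sum_eq_single u, Finset.sum_eq_single v] <;> simp +contextual
  have key : 2 * cutVal x (A \ B) + 2 * cutVal x (B \ A) + 2 * x u v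
      ≤ 2 * cutVal x A + 2 * cutVal x B := by
    rw [e]
    simp only [two_mul_cutVal hs, ← Finset.sum_add_distrib]
    refine Finset.sum_le_sum fun a _ => Finset.sum_le_sum fun b _ => ?_
    have := h0 a b
    by_cases hab : a = u ∧ b = v
    · obtain ⟨rfl, rfl⟩ := hab
      simp [huA, huB, hvA, hvB]
      linarith
    · rw [if_neg hab]
      by_cases h1 : a ∈ A <;> by_cases h2 : a ∈ B <;> by_cases h3 : b ∈ A <;>
        by_cases h4 : b ∈ B <;> simp [h1, h2, h3, h4] <;> linarith
  linarith

theorem cutVal_insert_of_neighbors (hs : ∀ a b, x a b = x b a) {M : Finset V} {v : V}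
    (hv : v ∉ M) (hN : ∀ w, w ≠ v → w ∉ M → x w v = 0) :
    cutVal x (insert v M) = cutVal x M - cutVal x {v} := by
  have e1 : cutVal x M = ∑ a ∈ M, ∑ b ∈ (insert v M)ᶜ, x a b + ∑ a ∈ M, x a v := by
    unfold cutVal
    have : (Mᶜ : Finset V) = insert v (insert v M)ᶜ := by
      ext a; simp only [Finset.mem_compl, Finset.mem_insert]; by_cases h : a = v <;> simp [h, hv]
    rw [this, ← Finset.sum_add_distrib]
    refine Finset.sum_congr rfl fun a _ => ?_
    rw [Finset.sum_insert (by simp)]; ring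
  have e2 : cutVal x {v} = ∑ a ∈ M, x a v := by
    rw [cutVal_singleton]
    have : ({v}ᶜ : Finset V) = M ∪ (insert v M)ᶜ := by
      ext a
      simp only [Finset.mem_compl, Finset.mem_insert, Finset.mem_singleton, Finset.mem_union]
      by_cases h : a = v <;> by_cases h' : a ∈ M <;> simp_all
    rw [this, Finset.sum_union (by
      rw [Finset.disjoint_left]; intro a ha hb; simp [ha] at hb)]
    rw [Finset.sum_eq_zero (s := (insert v M)ᶜ), add_zero]
    · exact Finset.sum_congr rfl fun a _ => hs _ _
    · intro b hb
      simp only [Finset.mem_compl, Finset.mem_insert, not_or] at hb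
      rw [hs]; exact hN b hb.1 hb.2
  rw [e1, e2]
  unfold cutVal
  rw [Finset.sum_insert hv, Finset.sum_eq_zero (s := (insert v M)ᶜ)]
  · ring
  · intro b hb
    simp only [Finset.mem_compl, Finset.mem_insert, not_or] at hb
    rw [hs]; exact hN b hb.1 hb.2

/-- The indicator of `u` minus the indicator of `v`. -/
def diffInd (u v a : V) : ℝ := (if a = u then 1 else 0) - (if a = v then 1 else 0)

/-- Split off the amount `ε` of the pairs `uv` and `vw`, with a compensating loop at `v`. -/
def splitOff (x : V → V → ℝ) (v u w : V) (ε : ℝ) (a b : V) : ℝ :=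
  x a b + ε * (diffInd u v a * diffInd w v b + diffInd w v a * diffInd u v b)

theorem sum_diffInd (u v : V) (S : Finset V) :
    ∑ a ∈ S, diffInd u v a = (if u ∈ S then 1 else 0) - (if v ∈ S then 1 else 0) := by
  simp [diffInd, Finset.sum_sub_distrib, Finset.sum_ite_eq']

theorem cutVal_splitOff (v u w : V) (ε : ℝ) (S : Finset V) :
    cutVal (splitOff x v u w ε) S = cutVal x S - 2 * ε *
      (((if u ∈ S then 1 else 0) - (if v ∈ S then 1 else 0)) *
       ((if w ∈ S then 1 else 0) - (if v ∈ S then 1 else 0))) := by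
  have hc : ∀ u : V, ∑ a ∈ Sᶜ, diffInd u v a = - ∑ a ∈ S, diffInd u v a := by
    intro u
    have := Finset.sum_add_sum_compl S (diffInd u v)
    rw [sum_diffInd u v Finset.univ] at this
    simp only [Finset.mem_univ, if_true] at this
    linarith
  unfold cutVal splitOff
  simp only [Finset.sum_add_distrib, ← Finset.mul_sum, ← Finset.sum_mul, hc]
  rw [sum_diffInd, sum_diffInd]
  ring

theorem sum_splitOff (v u w a : V) (ε : ℝ) :
    ∑ b, splitOff x v u w ε a b = ∑ b, x a b := by
  unfold splitOff
  simp only [Finset.sum_add_distrib, ← Finset.mul_sum, sum_diffInd]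
  simp

theorem sum_mul_splitOff {C : V → V → ℝ} (hC : ∀ a b, C a b = C b a) (hC0 : ∀ a, C a a = 0)
    (v u w : V) (ε : ℝ) :
    ∑ a, ∑ b, C a b * splitOff x v u w ε a b
      = ∑ a, ∑ b, C a b * x a b + 2 * ε * (C u w - C u v - C v w) := by
  have e : ∀ p q : V, ∑ a, ∑ b, C a b * ((if a = p then (1:ℝ) else 0) * (if b = q then 1 else 0))
      = C p q := by
    intro p q
    rw [Finset.sum_eq_single p, Finset.sum_eq_single q] <;> simp +contextual
  have e2 : ∀ a b, C a b * splitOff x v u w ε a b = C a b * x a b + ε * (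
      (C a b * ((if a = u then (1:ℝ) else 0) * (if b = w then 1 else 0))
      - C a b * ((if a = u then (1:ℝ) else 0) * (if b = v then 1 else 0))
      - C a b * ((if a = v then (1:ℝ) else 0) * (if b = w then 1 else 0))
      + C a b * ((if a = v then (1:ℝ) else 0) * (if b = v then 1 else 0)))
      + (C a b * ((if a = w then (1:ℝ) else 0) * (if b = u then 1 else 0))
      - C a b * ((if a = w then (1:ℝ) else 0) * (if b = v then 1 else 0))
      - C a b * ((if a = v then (1:ℝ) else 0) * (if b = u then 1 else 0))
      + C a b * ((if a = v then (1:ℝ) else 0) * (if b = v then 1 else 0)))) := by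
    intro a b; unfold splitOff diffInd; ring
  simp only [e2, Finset.sum_add_distrib, Finset.sum_sub_distrib, ← Finset.mul_sum, e]
  rw [hC w u, hC w v, hC v u, hC0 v]
  ring

theorem splitOff_symm (hs : ∀ a b, x a b = x b a) (v u w : V) (ε : ℝ) (a b : V) :
    splitOff x v u w ε a b = splitOff x v u w ε b a := by
  unfold splitOff; rw [hs a b]; ring

theorem splitOff_nonneg (hs : ∀ a b, x a b = x b a) (h0 : ∀ a b, 0 ≤ x a b) {v u w : V} {ε : ℝ}
    (huv : u ≠ v) (hwv : w ≠ v) (hε : 0 ≤ ε) (hu : 2 * ε ≤ x u v) (hw : 2 * ε ≤ x w v) (a b : V) :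
    0 ≤ splitOff x v u w ε a b := by
  have key : ∀ b, b ≠ v → 0 ≤ splitOff x v u w ε v b := by
    intro b hb
    have := h0 v b
    simp only [splitOff, diffInd, huv.symm, hwv.symm, hb, if_true, if_false]
    by_cases h1 : b = u
    · subst h1
      rw [hs v]
      by_cases h2 : b = w <;> simp only [h2, if_true, if_false] at * <;> linarith
    · by_cases h2 : b = w
      · subst h2
        rw [hs v]
        simp only [h1, if_true, if_false]
        linarith
      · simp only [h1, h2, if_false]
        linarith
  by_cases ha : a = v
  · by_cases hb : b = v
    · subst hb; subst ha
      have := h0 a a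
      simp only [splitOff, diffInd, huv.symm, hwv.symm, if_true, if_false]
      nlinarith
    · subst ha; exact key b hb
  · by_cases hb : b = v
    · subst hb; rw [splitOff_symm hs]; exact key a ha
    · have := h0 a b
      simp only [splitOff, diffInd, ha, hb, if_false, sub_zero]
      split_ifs <;> simp <;> linarith

variable {R : Finset V → ℝ}

theorem tight_union (hs : ∀ a b, x a b = x b a) (h0 : ∀ a b, 0 ≤ x a b)
    (hskew : ∀ A B, R A + R B ≤ R (A ∩ B) + R (A ∪ B) ∨ R A + R B ≤ R (A \ B) + R (B \ A))
    (hfeas : ∀ S, R S ≤ cutVal x S) {u v : V} (huv : 0 < x u v) {A B : Finset V}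
    (huA : u ∈ A) (huB : u ∈ B) (hvA : v ∉ A) (hvB : v ∉ B)
    (hA : cutVal x A = R A) (hB : cutVal x B = R B) :
    cutVal x (A ∪ B) = R (A ∪ B) := by
  have h1 := hfeas (A ∩ B)
  have h2 := hfeas (A ∪ B)
  rcases hskew A B with h | h
  · have := cutVal_inter_add_union hs h0 A B
    linarith
  · have := cutVal_sdiff_add_sdiff hs h0 A B huA huB hvA hvB
    have h3 := hfeas (A \ B)
    have h4 := hfeas (B \ A)
    linarith

theorem exists_splittable (hs : ∀ a b, x a b = x b a) (h0 : ∀ a b, 0 ≤ x a b)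
    (hskew : ∀ A B, R A + R B ≤ R (A ∩ B) + R (A ∪ B) ∨ R A + R B ≤ R (A \ B) + R (B \ A))
    (hfeas : ∀ S, R S ≤ cutVal x S) {v : V} (hRv : 0 ≤ R {v})
    (hins : ∀ X, v ∉ X → R X - R {v} ≤ R (insert v X)) (hlt : R {v} < cutVal x {v}) :
    ∃ u w, u ≠ v ∧ w ≠ v ∧ 0 < x u v ∧ 0 < x w v ∧
      ∀ X, v ∉ X → u ∈ X → w ∈ X → R X < cutVal x X := by
  classical
  have hpos : 0 < ∑ b ∈ {v}ᶜ, x v b := by rw [← cutVal_singleton]; linarith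
  obtain ⟨u, hu, hux⟩ := Finset.exists_lt_of_sum_lt (s := ({v}ᶜ : Finset V)) (f := fun _ => (0:ℝ))
    (g := fun b => x v b) (by simpa using hpos)
  have huv : u ≠ v := by simpa using hu
  have hux' : 0 < x u v := by rw [hs]; exact hux
  let F : Finset (Finset V) := Finset.univ.filter fun X => v ∉ X ∧ u ∈ X ∧ cutVal x X = R X
  by_cases hF : F.Nonempty
  · obtain ⟨M, hM, hmax⟩ := Finset.exists_max_image F Finset.card hF
    simp only [F, Finset.mem_filter, Finset.mem_univ, true_and] at hM hmax
    obtain ⟨hvM, huM, hMt⟩ := hM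
    have : ∃ w, w ≠ v ∧ w ∉ M ∧ x w v ≠ 0 := by
      by_contra! hcon
      have h1 := cutVal_insert_of_neighbors hs hvM hcon
      have h2 := hfeas (insert v M)
      have h3 := hins M hvM
      linarith
    obtain ⟨w, hwv, hwM, hwx⟩ := this
    refine ⟨u, w, huv, hwv, hux', lt_of_le_of_ne (h0 _ _) hwx.symm, fun X hvX huX hwX => ?_⟩
    refine lt_of_le_of_ne (hfeas X) fun hX => ?_
    have ht := tight_union hs h0 hskew hfeas hux' huM huX hvM hvX hMt hX.symm
    have hc := hmax (M ∪ X) ⟨by simp [hvM, hvX], by simp [huM], ht⟩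
    have := Finset.eq_of_subset_of_card_le (Finset.subset_union_left (s₁ := M) (s₂ := X)) hc
    exact hwM (this ▸ Finset.mem_union_right _ hwX)
  · refine ⟨u, u, huv, huv, hux', hux', fun X hvX huX _ => ?_⟩
    refine lt_of_le_of_ne (hfeas X) fun hX => hF ⟨X, ?_⟩
    simp [F, hvX, huX, hX]

/-- Splitting off at `v` until the cut value of `v` meets its requirement, without increasing any
cut value or the cost. -/
theorem exists_complete_splitting (hs : ∀ a b, x a b = x b a) (h0 : ∀ a b, 0 ≤ x a b)
    (hsymm : ∀ S, R Sᶜ = R S)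
    (hskew : ∀ A B, R A + R B ≤ R (A ∩ B) + R (A ∪ B) ∨ R A + R B ≤ R (A \ B) + R (B \ A))
    (hfeas : ∀ S, R S ≤ cutVal x S) {v : V} (hRv : 0 ≤ R {v})
    (hins : ∀ X, v ∉ X → R X - R {v} ≤ R (insert v X))
    {C : V → V → ℝ} (hC : ∀ a b, C a b = C b a) (hC0 : ∀ a, C a a = 0) (A : Finset V)
    (hA : ∀ a, a ∉ A → cutVal x {a} = 0)
    (htri : ∀ u ∈ A, ∀ w ∈ A, u ≠ v → w ≠ v → C u w ≤ C u v + C v w) :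
    ∃ x' : V → V → ℝ, (∀ a b, x' a b = x' b a) ∧ (∀ a b, 0 ≤ x' a b) ∧
      (∀ S, cutVal x' S ≤ cutVal x S) ∧ (∀ S, R S ≤ cutVal x' S) ∧ cutVal x' {v} = R {v} ∧
      ∑ a, ∑ b, C a b * x' a b ≤ ∑ a, ∑ b, C a b * x a b := by
  have hcont : ∀ S : Finset V, Continuous fun z : V → V → ℝ => cutVal z S := by
    intro S; unfold cutVal; fun_prop
  let K : Set (V → V → ℝ) := Set.Icc 0 (fun a _ => ∑ b, x a b) ∩
    {z | (∀ a b, z a b = z b a) ∧ (∀ a, ∑ b, z a b = ∑ b, x a b) ∧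
      (∀ S, cutVal z S ≤ cutVal x S) ∧ (∀ S, R S ≤ cutVal z S) ∧
      ∑ a, ∑ b, C a b * z a b ≤ ∑ a, ∑ b, C a b * x a b}
  have hK : IsCompact K := by
    refine isCompact_Icc.inter_right ?_
    simp only [Set.ofPred_and, Set.ofPred_forall]
    refine IsClosed.inter ?_ (IsClosed.inter ?_ (IsClosed.inter ?_ (IsClosed.inter ?_ ?_)))
    · exact isClosed_iInter fun a => isClosed_iInter fun b =>
        isClosed_eq (by fun_prop) (by fun_prop)
    · exact isClosed_iInter fun a => isClosed_eq (by fun_prop) (by fun_prop)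
    · exact isClosed_iInter fun S => isClosed_le (hcont S) continuous_const
    · exact isClosed_iInter fun S => isClosed_le continuous_const (hcont S)
    · exact isClosed_le (by fun_prop) continuous_const
  have hxK : x ∈ K := by
    refine ⟨⟨fun a b => h0 a b, fun a b => ?_⟩, hs, fun _ => rfl, fun _ => le_rfl, hfeas, le_rfl⟩
    exact Finset.single_le_sum (f := fun b => x a b) (fun _ _ => h0 _ _) (Finset.mem_univ b)
  obtain ⟨z, hzK, hmin⟩ := hK.exists_isMinOn ⟨x, hxK⟩ (hcont {v}).continuousOn
  obtain ⟨⟨hz0, _⟩, hzs, hzrow, hzle, hzR, hzC⟩ := hzK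
  replace hz0 : ∀ a b, 0 ≤ z a b := fun a b => hz0 a b
  refine ⟨z, hzs, hz0, hzle, hzR, ?_, hzC⟩
  by_contra hne
  have hlt : R {v} < cutVal z {v} := lt_of_le_of_ne (hzR _) (Ne.symm hne)
  obtain ⟨u, w, huv, hwv, hux, hwx, hsplit⟩ := exists_splittable hzs hz0 hskew hzR hRv hins hlt
  have hmem : ∀ a, a ≠ v → 0 < z a v → a ∈ A := by
    intro a hav hpos
    by_contra haA
    have h1 := hA a haA
    have h2 := hzle {a}
    have h3 := le_cutVal hz0 (S := {a}) (a := a) (b := v) (by simp) (by simpa using hav.symm)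
    linarith
  have hev : ∀ᶠ ε in nhdsWithin (0:ℝ) (Set.Ioi 0), 0 < ε ∧ 2 * ε < z u v ∧ 2 * ε < z w v ∧
      ∀ S : Finset V, R S < cutVal z S → R S < cutVal z S - 2 * ε := by
    have hlim : ∀ t : ℝ, 0 < t → ∀ᶠ ε in nhdsWithin (0:ℝ) (Set.Ioi 0), 2 * ε < t := by
      intro t ht
      filter_upwards [Ioo_mem_nhdsGT (show (0:ℝ) < t / 2 by linarith)] with ε hε
      linarith [hε.2]
    refine Filter.Eventually.and self_mem_nhdsWithin ((hlim _ hux).and ((hlim _ hwx).and ?_))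
    refine Filter.eventually_all.2 fun S => ?_
    by_cases hS : R S < cutVal z S
    · filter_upwards [hlim (cutVal z S - R S) (by linarith)] with ε hε _
      linarith
    · exact Filter.Eventually.of_forall fun _ h => absurd h hS
  obtain ⟨ε, hε, hεu, hεw, hεS⟩ := hev.exists
  have hnn := splitOff_nonneg hzs hz0 huv hwv hε.le hεu.le hεw.le
  have hz' : splitOff z v u w ε ∈ K := by
    refine ⟨⟨fun a b => hnn a b, fun a b => ?_⟩, splitOff_symm hzs v u w ε, fun a => ?_,
      fun S => ?_, fun S => ?_, ?_⟩
    · dsimp only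
      rw [← hzrow a, ← sum_splitOff v u w a ε]
      exact Finset.single_le_sum (f := fun b => splitOff z v u w ε a b) (fun _ _ => hnn _ _)
        (Finset.mem_univ b)
    · rw [sum_splitOff, hzrow]
    · refine le_trans ?_ (hzle S)
      rw [cutVal_splitOff]
      by_cases h1 : u ∈ S <;> by_cases h2 : v ∈ S <;> by_cases h3 : w ∈ S <;>
        simp [h1, h2, h3] <;> linarith
    · rw [cutVal_splitOff]
      have hfe := hzR S
      by_cases h2 : v ∈ S
      · by_cases h1 : u ∈ S
        · simpa [h1, h2] using hfe
        · by_cases h3 : w ∈ S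
          · simpa [h2, h3] using hfe
          · have h4 := hsplit Sᶜ (by simpa using h2) (by simpa using h1) (by simpa using h3)
            rw [hsymm, cutVal_compl hzs] at h4
            have := hεS S h4
            simp only [h1, h2, h3, if_true, if_false]
            linarith
      · by_cases h1 : u ∈ S
        · by_cases h3 : w ∈ S
          · have := hεS S (hsplit S h2 h1 h3)
            simp only [h1, h2, h3, if_true, if_false]
            linarith
          · simpa [h2, h3] using hfe
        · simpa [h1, h2] using hfe
    · refine le_trans ?_ hzC
      rw [sum_mul_splitOff hC hC0]
      have := htri u (hmem u huv hux) w (hmem w hwv hwx) huv hwv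
      nlinarith
  have hfin := hmin hz'
  simp only [Set.mem_ofPred_eq] at hfin
  rw [cutVal_splitOff] at hfin
  simp only [Finset.mem_singleton, huv, hwv, if_true, if_false] at hfin
  linarith

end CutFunction

section SeparationRequirement

variable {V : Type*} [Fintype V] [DecidableEq V]

/-- The largest requirement `ρ u` of a vertex `u ∈ B` separated from `r` by `S`. -/
noncomputable def sepReq (r : V) (B : Finset V) (ρ : V → ℝ) (S : Finset V) : ℝ :=
  ⨆ u, if u ∈ B ∧ ¬(u ∈ S ↔ r ∈ S) then ρ u else 0

variable {r : V} {B : Finset V} {ρ : V → ℝ}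

theorem le_sepReq {S : Finset V} {u : V} (hu : u ∈ B) (h : ¬(u ∈ S ↔ r ∈ S)) :
    ρ u ≤ sepReq r B ρ S := by
  refine le_trans (le_of_eq ?_) (le_ciSup (Set.finite_range _).bddAbove u)
  rw [if_pos ⟨hu, h⟩]

theorem sepReq_nonneg (hρ : ∀ u, 0 ≤ ρ u) (S : Finset V) : 0 ≤ sepReq r B ρ S :=
  Real.iSup_nonneg fun u => by split_ifs <;> simp [hρ]

theorem sepReq_le {S : Finset V} {t : ℝ} (ht : 0 ≤ t)
    (h : ∀ u ∈ B, ¬(u ∈ S ↔ r ∈ S) → ρ u ≤ t) : sepReq r B ρ S ≤ t := by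
  have : Nonempty V := ⟨r⟩
  refine ciSup_le fun u => ?_
  split_ifs with hu
  · exact h u hu.1 hu.2
  · exact ht

theorem sepReq_compl (S : Finset V) : sepReq r B ρ Sᶜ = sepReq r B ρ S := by
  unfold sepReq
  simp only [Finset.mem_compl, not_iff_not]

theorem sepReq_attained (S : Finset V) :
    sepReq r B ρ S = 0 ∨ ∃ u ∈ B, ¬(u ∈ S ↔ r ∈ S) ∧ sepReq r B ρ S = ρ u := by
  have : Nonempty V := ⟨r⟩
  obtain ⟨u, hu⟩ := exists_eq_ciSup_of_finite
    (f := fun u => if u ∈ B ∧ ¬(u ∈ S ↔ r ∈ S) then ρ u else 0)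
  by_cases h : u ∈ B ∧ ¬(u ∈ S ↔ r ∈ S)
  · right
    refine ⟨u, h.1, h.2, ?_⟩
    unfold sepReq
    rw [← hu, if_pos h]
  · left
    unfold sepReq
    rw [← hu, if_neg h]

theorem sepReq_skew (hρ : ∀ u, 0 ≤ ρ u) (X Y : Finset V) :
    sepReq r B ρ X + sepReq r B ρ Y ≤ sepReq r B ρ (X ∩ Y) + sepReq r B ρ (X ∪ Y) ∨
      sepReq r B ρ X + sepReq r B ρ Y ≤ sepReq r B ρ (X \ Y) + sepReq r B ρ (Y \ X) := by
  have n1 := sepReq_nonneg (r := r) (B := B) hρ (X ∩ Y)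
  have n2 := sepReq_nonneg (r := r) (B := B) hρ (X ∪ Y)
  have n3 := sepReq_nonneg (r := r) (B := B) hρ (X \ Y)
  have n4 := sepReq_nonneg (r := r) (B := B) hρ (Y \ X)
  have single : ∀ u ∈ B, ¬(u ∈ X ↔ r ∈ X) ∨ ¬(u ∈ Y ↔ r ∈ Y) →
      ρ u ≤ sepReq r B ρ (X ∩ Y) + sepReq r B ρ (X ∪ Y) ∨
      ρ u ≤ sepReq r B ρ (X \ Y) + sepReq r B ρ (Y \ X) := by
    intro u hu h
    have : (¬(u ∈ X ∩ Y ↔ r ∈ X ∩ Y) ∨ ¬(u ∈ X ∪ Y ↔ r ∈ X ∪ Y)) ∨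
        (¬(u ∈ X \ Y ↔ r ∈ X \ Y) ∨ ¬(u ∈ Y \ X ↔ r ∈ Y \ X)) := by
      simp only [Finset.mem_inter, Finset.mem_union, Finset.mem_sdiff]
      revert h
      by_cases h1 : u ∈ X <;> by_cases h2 : u ∈ Y <;> by_cases h3 : r ∈ X <;>
        by_cases h4 : r ∈ Y <;> simp [h1, h2, h3, h4]
    rcases this with (h | h) | (h | h) <;> have := le_sepReq (ρ := ρ) hu h
    · left; linarith
    · left; linarith
    · right; linarith
    · right; linarith
  rcases sepReq_attained (r := r) (B := B) (ρ := ρ) X with hX | ⟨u, hu, huX, hX⟩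
  · rcases sepReq_attained (r := r) (B := B) (ρ := ρ) Y with hY | ⟨w, hw, hwY, hY⟩
    · left; linarith
    · rw [hX, hY, zero_add]; exact single w hw (Or.inr hwY)
  · rcases sepReq_attained (r := r) (B := B) (ρ := ρ) Y with hY | ⟨w, hw, hwY, hY⟩
    · rw [hX, hY, add_zero]; exact single u hu (Or.inl huX)
    · rw [hX, hY]
      have : (¬(u ∈ X ∩ Y ↔ r ∈ X ∩ Y) ∧ ¬(w ∈ X ∪ Y ↔ r ∈ X ∪ Y)) ∨
          (¬(w ∈ X ∩ Y ↔ r ∈ X ∩ Y) ∧ ¬(u ∈ X ∪ Y ↔ r ∈ X ∪ Y)) ∨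
          (¬(u ∈ X \ Y ↔ r ∈ X \ Y) ∧ ¬(w ∈ Y \ X ↔ r ∈ Y \ X)) ∨
          (¬(w ∈ X \ Y ↔ r ∈ X \ Y) ∧ ¬(u ∈ Y \ X ↔ r ∈ Y \ X)) := by
        simp only [Finset.mem_inter, Finset.mem_union, Finset.mem_sdiff]
        revert huX hwY
        by_cases h1 : u ∈ X <;> by_cases h2 : u ∈ Y <;> by_cases h3 : r ∈ X <;>
          by_cases h4 : r ∈ Y <;> by_cases h5 : w ∈ X <;> by_cases h6 : w ∈ Y <;>
          simp [h1, h2, h3, h4, h5, h6]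
      rcases this with ⟨h1, h2⟩ | ⟨h1, h2⟩ | ⟨h1, h2⟩ | ⟨h1, h2⟩
      · have := le_sepReq (ρ := ρ) hu h1
        have := le_sepReq (ρ := ρ) hw h2
        left; linarith
      · have := le_sepReq (ρ := ρ) hw h1
        have := le_sepReq (ρ := ρ) hu h2
        left; linarith
      · have := le_sepReq (ρ := ρ) hu h1
        have := le_sepReq (ρ := ρ) hw h2
        right; linarith
      · have := le_sepReq (ρ := ρ) hw h1
        have := le_sepReq (ρ := ρ) hu h2
        right; linarith

end SeparationRequirement

section Parents

variable {V : Type*}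

/-- A tree on `W` rooted at `r`, given by parents and a rank that decreases towards the root. -/
structure IsRootedTree (r : V) (W : Finset V) (par : V → V) (rk : V → ℕ) : Prop where
  root_mem : r ∈ W
  par_mem : ∀ v ∈ W, v ≠ r → par v ∈ W
  rk_lt : ∀ v ∈ W, v ≠ r → rk (par v) < rk v

theorem IsRootedTree.par_ne {r : V} {W : Finset V} {par : V → V} {rk : V → ℕ}
    (h : IsRootedTree r W par rk) {v : V} (hv : v ∈ W) (hr : v ≠ r) : par v ≠ v :=
  fun e => by have := h.rk_lt v hv hr; rw [e] at this; exact lt_irrefl _ this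

end Parents

section RootedTree

variable {V : Type*} [Fintype V] [DecidableEq V]

/-- `x` is a symmetric weighting supported on `A` that satisfies the connectivity requirements `y`
of the vertices of `A` with respect to the root `r`. -/
structure CutFeasible (r : V) (A : Finset V) (y : V → ℝ) (x : V → V → ℝ) : Prop where
  symm : ∀ a b, x a b = x b a
  nonneg : ∀ a b, 0 ≤ x a b
  supp : ∀ a, a ∉ A → cutVal x {a} = 0
  cut : ∀ S, r ∉ S → ∀ u ∈ S, u ∈ A → 2 * y u ≤ cutVal x S

theorem CutFeasible.exists_erase {r v : V} {A : Finset V} {y : V → ℝ} {x : V → V → ℝ}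
    (hx : CutFeasible r A y x) (hy : ∀ u, 0 ≤ y u) (hvr : v ≠ r)
    {C : V → V → ℝ} (hC : ∀ a b, C a b = C b a) (hC0 : ∀ a, C a a = 0)
    (htri : ∀ u ∈ A, ∀ w ∈ A, u ≠ v → w ≠ v → C u w ≤ C u v + C v w) :
    ∃ x', CutFeasible r (A.erase v) y x' ∧
      ∑ a, ∑ b, C a b * x' a b ≤ ∑ a, ∑ b, C a b * x a b := by
  have hρ : ∀ u, 0 ≤ 2 * y u := fun u => by have := hy u; linarith
  have hone : sepReq r (A.erase v) (fun u => 2 * y u) {v} = 0 := by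
    refine le_antisymm (sepReq_le le_rfl fun u hu h => absurd ?_ h) (sepReq_nonneg hρ _)
    simp [Finset.ne_of_mem_erase hu, hvr.symm]
  have hfeas : ∀ S, sepReq r (A.erase v) (fun u => 2 * y u) S ≤ cutVal x S := fun S => by
    refine sepReq_le (cutVal_nonneg hx.nonneg _) fun u hu h => ?_
    by_cases hrS : r ∈ S
    · rw [← cutVal_compl hx.symm]
      exact hx.cut _ (by simpa using hrS) u (by simp_all) (Finset.mem_of_mem_erase hu)
    · exact hx.cut _ hrS u (by simp_all) (Finset.mem_of_mem_erase hu)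
  have hins : ∀ X, v ∉ X → sepReq r (A.erase v) (fun u => 2 * y u) X -
      sepReq r (A.erase v) (fun u => 2 * y u) {v} ≤
        sepReq r (A.erase v) (fun u => 2 * y u) (insert v X) := fun X _ => by
    rw [hone, sub_zero]
    refine sepReq_le (sepReq_nonneg hρ _) fun u hu h => ?_
    refine le_sepReq (ρ := fun u => 2 * y u) hu ?_
    simpa [Finset.mem_insert, Finset.ne_of_mem_erase hu, hvr.symm] using h
  obtain ⟨x', h1, h2, h3, h4, h5, h6⟩ := exists_complete_splitting
    (R := sepReq r (A.erase v) (fun u => 2 * y u)) hx.symm hx.nonneg sepReq_compl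
    (sepReq_skew hρ) hfeas (v := v) hone.ge hins hC hC0 A hx.supp htri
  refine ⟨x', ⟨h1, h2, fun a ha => ?_, fun S hrS u hu huA => ?_⟩, h6⟩
  · by_cases hav : a = v
    · rw [hav, h5, hone]
    · exact le_antisymm ((h3 _).trans_eq (hx.supp a fun h => ha (by simp [hav, h])))
        (cutVal_nonneg h2 _)
  · exact (le_sepReq (ρ := fun u => 2 * y u) huA (by simp [hu, hrS])).trans (h4 S)

/-- The vertices outside a set `L` avoiding the root can be eliminated under metric costs. -/
theorem CutFeasible.exists_sdiff {r : V} {A : Finset V} {y : V → ℝ} {x : V → V → ℝ}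
    (hx : CutFeasible r A y x) (hy : ∀ u, 0 ≤ y u)
    {C : V → V → ℝ} (hC : ∀ a b, C a b = C b a) (hC0 : ∀ a, C a a = 0)
    (htri : ∀ u v w, C u w ≤ C u v + C v w) (L : Finset V) (hL : r ∉ L) :
    ∃ x', CutFeasible r (A \ L) y x' ∧
      ∑ a, ∑ b, C a b * x' a b ≤ ∑ a, ∑ b, C a b * x a b := by
  induction L using Finset.induction_on with
  | empty => exact ⟨x, by simpa using hx, le_rfl⟩
  | insert v L _ ih =>
    simp only [Finset.mem_insert, not_or] at hL
    obtain ⟨x₁, hx₁, hc₁⟩ := ih hL.2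
    obtain ⟨x₂, hx₂, hc₂⟩ := hx₁.exists_erase hy (Ne.symm hL.1) hC hC0
      (fun u _ w _ _ _ => htri u v w)
    refine ⟨x₂, ?_, hc₂.trans hc₁⟩
    rwa [Finset.sdiff_insert]

/-- Adding `v` to a tree as a leaf. -/
theorem IsRootedTree.add_leaf {r : V} {W : Finset V} {par : V → V} {rk : V → ℕ}
    (h : IsRootedTree r W par rk) {u v : V} (hu : u ∈ W) (hv : v ∉ W) :
    IsRootedTree r (insert v W) (Function.update par v u) (Function.update rk v (rk u + 1)) := by
  have hne : ∀ a ∈ W, a ≠ v := fun a ha e => hv (e ▸ ha)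
  refine ⟨by simp [h.root_mem], fun a ha har => ?_, fun a ha har => ?_⟩
  · by_cases hav : a = v
    · subst hav; simp [hu]
    · rw [Function.update_of_ne hav]
      exact Finset.mem_insert_of_mem (h.par_mem a (Finset.mem_of_mem_insert_of_ne ha hav) har)
  · by_cases hav : a = v
    · subst hav; simp [hne u hu]
    · have haW := Finset.mem_of_mem_insert_of_ne ha hav
      rw [Function.update_of_ne hav, Function.update_of_ne hav,
        Function.update_of_ne (hne _ (h.par_mem a haW har))]
      exact h.rk_lt a haW har

/-- Subdividing the edge from `j` to its parent by `v`, and moving the vertices of `Sp`, none of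
which has smaller rank than `j`, below `v`. -/
theorem IsRootedTree.subdivide {r : V} {W : Finset V} {par : V → V} {rk : V → ℕ}
    (h : IsRootedTree r W par rk) {j v : V} {Sp : Finset V} (hj : j ∈ W) (hjr : j ≠ r)
    (hv : v ∉ W) (hmin : ∀ u ∈ Sp, rk j ≤ rk u) :
    IsRootedTree r (insert v W) (fun a => if a = v then par j else if a ∈ Sp then v else par a)
      (fun a => if a = v then 2 * rk j - 1 else 2 * rk a) := by
  have hne : ∀ a ∈ W, a ≠ v := fun a ha e => hv (e ▸ ha)
  have hpj := h.par_mem j hj hjr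
  have hrj := h.rk_lt j hj hjr
  refine ⟨by simp [h.root_mem], fun a ha har => ?_, fun a ha har => ?_⟩
  · split_ifs with h1 h2
    · exact Finset.mem_insert_of_mem hpj
    · exact Finset.mem_insert_self _ _
    · exact Finset.mem_insert_of_mem (h.par_mem a (Finset.mem_of_mem_insert_of_ne ha h1) har)
  · by_cases hav : a = v
    · simp only [hav, if_true, if_neg (hne _ hpj)]
      omega
    · have haW := Finset.mem_of_mem_insert_of_ne ha hav
      by_cases haS : a ∈ Sp
      · have := hmin a haS
        simp only [hav, haS, if_true, if_false]
        omega
      · have := h.rk_lt a haW har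
        simp only [hav, haS, if_false, if_neg (hne _ (h.par_mem a haW har))]
        omega

/-- The Lagrangian relaxation bound: some rooted tree has cost plus penalties at most those of the
fractional solution. -/
theorem exists_rootedTree {r : V} {y : V → ℝ} (hy : ∀ u, 0 ≤ y u) (hy1 : ∀ u, y u ≤ 1)
    (hyr : y r = 1) (n : ℕ) : ∀ (A : Finset V), A.card = n → r ∈ A →
    ∀ (c x : V → V → ℝ) (p : V → ℝ), (∀ a b, c a b = c b a) → (∀ a, c a a = 0) →
      (∀ a ∈ A, ∀ b ∈ A, 0 ≤ c a b) → (∀ a, 0 ≤ p a) → CutFeasible r A y x →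
      ∃ (W : Finset V) (par : V → V) (rk : V → ℕ), W ⊆ A ∧ IsRootedTree r W par rk ∧
        ∑ v ∈ W.erase r, c v (par v) + ∑ v ∈ A \ W, p v
          ≤ (1 / 2) * ∑ a, ∑ b, c a b * x a b + ∑ v ∈ A, p v * (1 - y v) := by
  induction n with
  | zero =>
    intro A hA hr
    rw [Finset.card_eq_zero] at hA
    simp [hA] at hr
  | succ n ih =>
    intro A hA hr c x p hc hc0 hcA hp hx
    by_cases hAr : A.erase r = ∅
    · have hA' : A = {r} := by
        rw [← Finset.insert_erase hr, hAr]; rfl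
      refine ⟨{r}, id, fun _ => 0, by simp [hr], ⟨by simp, by simp, by simp⟩, ?_⟩
      have : ∑ a, ∑ b, c a b * x a b = 0 := by
        refine Finset.sum_eq_zero fun a _ => Finset.sum_eq_zero fun b _ => ?_
        by_cases hab : a = b
        · simp [hab, hc0]
        · have hz : ∀ a b, a ≠ b → a ≠ r → x a b = 0 := fun a b hab har =>
            le_antisymm ((le_cutVal hx.nonneg (S := {a}) (by simp) (by simpa using hab.symm)).trans
              (hx.supp a (by simpa [hA'] using har)).le) (hx.nonneg _ _)
          by_cases har : a = r
          · rw [hx.symm, hz b a (Ne.symm hab) (fun h => hab (har.trans h.symm)), mul_zero]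
          · rw [hz a b hab har, mul_zero]
      rw [this]
      simp [hA', hyr]
    · obtain ⟨v, hvA', hvmin⟩ := Finset.exists_min_image (A.erase r) y
        (Finset.nonempty_iff_ne_empty.2 hAr)
      obtain ⟨hvr, hvA⟩ := Finset.mem_erase.1 hvA'
      have hrA' : r ∈ A.erase v := Finset.mem_erase.2 ⟨hvr.symm, hr⟩
      obtain ⟨s, hsA', hsmin⟩ := Finset.exists_min_image (A.erase v) (fun u => c u v) ⟨r, hrA'⟩
      obtain ⟨hsv, hsA⟩ := Finset.mem_erase.1 hsA'
      have hys : y v ≤ y s := by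
        by_cases hsr : s = r
        · rw [hsr, hyr]; exact hy1 v
        · exact hvmin s (Finset.mem_erase.2 ⟨hsr, hsA⟩)
      obtain ⟨m, hm⟩ : ∃ m, m = min (c s v) (p v) := ⟨_, rfl⟩
      have hms : m ≤ c s v := hm ▸ min_le_left _ _
      have hmp : m ≤ p v := hm ▸ min_le_right _ _
      have hm0 : 0 ≤ m := hm ▸ le_min (hcA _ hsA _ hvA) (hp v)
      have hmc : ∀ u ∈ A.erase v, m ≤ c u v := fun u hu => hms.trans (hsmin u hu)
      obtain ⟨C, hCdef⟩ : ∃ C : V → V → ℝ, C = fun a b => if a = b then 0 else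
        if a = v ∨ b = v then c a b - m / 2 else min (c a b) (c a v + c v b - m) := ⟨_, rfl⟩
      have hCsymm : ∀ a b, C a b = C b a := by
        intro a b
        simp only [hCdef, eq_comm (a := a) (b := b), or_comm (a := a = v), hc a b, hc a v, hc v b,
          add_comm (c v a)]
      have hC0 : ∀ a, C a a = 0 := by intro a; simp [hCdef]
      have hCin : ∀ a b, a ≠ b → a ≠ v → b ≠ v → C a b = min (c a b) (c a v + c v b - m) := by
        intro a b h1 h2 h3; simp [hCdef, h1, h2, h3]
      have hCv : ∀ a, a ≠ v → C a v = c a v - m / 2 := by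
        intro a h1; simp [hCdef, h1]
      have hCcost : ∑ a, ∑ b, C a b * x a b ≤ ∑ a, ∑ b, c a b * x a b - 2 * m * y v := by
        have e1 := cutVal_eq_sum_ite (x := x) {v}
        have e2 := cutVal_eq_sum_ite (x := x) {v}ᶜ
        rw [cutVal_compl hx.symm] at e2
        have e3 := hx.cut {v} (by simpa using hvr.symm) v (by simp) hvA
        have e4 : ∑ a, ∑ b, C a b * x a b ≤ ∑ a, ∑ b, (c a b * x a b
            - m / 2 * (if a ∈ ({v} : Finset V) ∧ b ∉ ({v} : Finset V) then x a b else 0)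
            - m / 2 * (if a ∈ ({v}ᶜ : Finset V) ∧ b ∉ ({v}ᶜ : Finset V) then x a b else 0)) := by
          refine Finset.sum_le_sum fun a _ => Finset.sum_le_sum fun b _ => ?_
          have hxab := hx.nonneg a b
          by_cases hab : a = b
          · subst hab; simp [hC0, hc0]
          · by_cases hav : a = v
            · subst hav
              rw [hCsymm, hCv b (Ne.symm hab), hc b a]
              simp [Ne.symm hab]
              linarith
            · by_cases hbv : b = v
              · subst hbv
                rw [hCv a hab]
                simp [hab]
                linarith
              · rw [hCin a b hab hav hbv]
                simp only [Finset.mem_singleton, Finset.mem_compl, hav, hbv, not_true_eq_false,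
                  and_false, false_and, if_false, not_false_eq_true, mul_zero, sub_zero]
                exact mul_le_mul_of_nonneg_right (min_le_left _ _) hxab
        simp only [Finset.sum_sub_distrib, ← Finset.mul_sum] at e4
        rw [← e1, ← e2] at e4
        have := mul_le_mul_of_nonneg_left e3 hm0
        linarith
      obtain ⟨x', hx', hcx'⟩ := hx.exists_erase hy hvr hCsymm hC0 (by
        intro u hu w hw huv hwv
        rw [hCv u huv, hCsymm v w, hCv w hwv]
        have h1 := hmc u (Finset.mem_erase.2 ⟨huv, hu⟩)
        have h2 := hmc w (Finset.mem_erase.2 ⟨hwv, hw⟩)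
        by_cases huw : u = w
        · subst huw; rw [hC0]; linarith
        · rw [hCin u w huw huv hwv]
          refine (min_le_right _ _).trans ?_
          rw [hc v w]; linarith)
      have hcard : (A.erase v).card = n := by rw [Finset.card_erase_of_mem hvA, hA]; rfl
      have hCnn : ∀ a ∈ A.erase v, ∀ b ∈ A.erase v, 0 ≤ C a b := by
        intro a ha b hb
        obtain ⟨hav, haA⟩ := Finset.mem_erase.1 ha
        obtain ⟨hbv, hbA⟩ := Finset.mem_erase.1 hb
        by_cases hab : a = b
        · subst hab; rw [hC0]
        · rw [hCin a b hab hav hbv]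
          have h1 := hmc a ha
          have h2 := hcA v hvA b hbA
          exact le_min (hcA a haA b hbA) (by linarith)
      obtain ⟨W, par, rk, hWA, hT, hcost⟩ := ih (A.erase v) hcard hrA' C x'
        (fun a => p a + if a = s then p v - m else 0) hCsymm hC0 hCnn
        (fun a => by
          have := hp a
          split_ifs <;> linarith) hx'
      have hvW : v ∉ W := fun h => Finset.notMem_erase v A (hWA h)
      have hneW : ∀ a ∈ W, a ≠ v := fun a ha e => hvW (e ▸ ha)
      have eR : ∑ a ∈ A.erase v, (p a + if a = s then p v - m else 0) * (1 - y a)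
          = ∑ a ∈ A.erase v, p a * (1 - y a) + (p v - m) * (1 - y s) := by
        simp only [add_mul, Finset.sum_add_distrib, ite_mul, zero_mul,
          Finset.sum_ite_eq', if_pos hsA']
      have eL : ∑ a ∈ A.erase v \ W, (p a + if a = s then p v - m else 0)
          = ∑ a ∈ A.erase v \ W, p a + if s ∈ W then 0 else p v - m := by
        rw [Finset.sum_add_distrib, Finset.sum_ite_eq']
        by_cases hsW : s ∈ W <;> simp [hsW, hsA, hsv]
      rw [eR, eL] at hcost
      have eA : ∑ a ∈ A, p a * (1 - y a)
          = ∑ a ∈ A.erase v, p a * (1 - y a) + p v * (1 - y v) :=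
        (Finset.sum_erase_add _ _ hvA).symm
      have hbound : ∑ u ∈ W.erase r, C u (par u) + ∑ a ∈ A.erase v \ W, p a
          + (if s ∈ W then 0 else p v - m) + m
          ≤ (1 / 2) * ∑ a, ∑ b, c a b * x a b + ∑ v ∈ A, p v * (1 - y v) := by
        rw [eA]
        have : (p v - m) * (1 - y s) ≤ (p v - m) * (1 - y v) :=
          mul_le_mul_of_nonneg_left (by linarith) (by linarith)
        linarith
      have eAW : A \ insert v W = A.erase v \ W := by
        ext a; simp only [Finset.mem_sdiff, Finset.mem_insert, Finset.mem_erase]; tauto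
      have hWA' : insert v W ⊆ A := Finset.insert_subset hvA (hWA.trans (Finset.erase_subset _ _))
      have hWr : (insert v W).erase r = insert v (W.erase r) := by
        rw [Finset.erase_insert_of_ne hvr]
      have hvWr : v ∉ W.erase r := fun h => hvW (Finset.mem_of_mem_erase h)
      have hite : 0 ≤ (if s ∈ W then 0 else p v - m) := by
        split_ifs <;> linarith
      by_cases hSp : ((W.erase r).filter fun u => C u (par u) ≠ c u (par u)).Nonempty
      · obtain ⟨j, hj, hjmin⟩ := Finset.exists_min_image _ rk hSp
        rw [Finset.mem_filter, Finset.mem_erase] at hj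
        have hspec : ∀ u ∈ W.erase r, C u (par u) ≠ c u (par u) →
            C u (par u) = c u v + c v (par u) - m := by
          intro u hu h
          obtain ⟨hur, huW⟩ := Finset.mem_erase.1 hu
          rw [hCin u (par u) (hT.par_ne huW hur).symm (hneW u huW)
            (hneW _ (hT.par_mem u huW hur))] at h ⊢
          exact (min_choice _ _).resolve_left h
        refine ⟨_, _, _, hWA', hT.subdivide hj.1.2 hj.1.1 hvW hjmin, ?_⟩
        rw [eAW, hWr, Finset.sum_insert hvWr]
        have hsum : ∑ u ∈ W.erase r, c u (if u = v then par j else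
            if u ∈ (W.erase r).filter fun u => C u (par u) ≠ c u (par u) then v else par u)
            ≤ ∑ u ∈ W.erase r, (C u (par u) + if u = j then m - c v (par j) else 0) := by
          refine Finset.sum_le_sum fun u hu => ?_
          obtain ⟨hur, huW⟩ := Finset.mem_erase.1 hu
          rw [if_neg (hneW u huW)]
          by_cases hu2 : C u (par u) = c u (par u)
          · have : u ≠ j := fun e => hj.2 (e ▸ hu2)
            simp [hu2, this]
          · rw [if_pos (Finset.mem_filter.2 ⟨hu, hu2⟩)]
            have e := hspec u hu hu2
            by_cases huj : u = j
            · subst huj; rw [if_pos rfl]; linarith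
            · rw [if_neg huj]
              have := hmc (par u) (hWA (hT.par_mem u huW hur))
              rw [hc (par u)] at this
              linarith
        rw [Finset.sum_add_distrib, Finset.sum_ite_eq', if_pos (Finset.mem_erase.2 hj.1)] at hsum
        simp only [if_true]
        linarith
      · have hCc : ∑ u ∈ W.erase r, C u (par u) = ∑ u ∈ W.erase r, c u (par u) := by
          refine Finset.sum_congr rfl fun u hu => ?_
          by_contra h
          exact hSp ⟨u, Finset.mem_filter.2 ⟨hu, h⟩⟩
        rw [hCc] at hbound
        by_cases hadd : s ∈ W ∧ c s v ≤ p v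
        · refine ⟨_, _, _, hWA', hT.add_leaf hadd.1 hvW, ?_⟩
          rw [eAW, hWr, Finset.sum_insert hvWr, Function.update_self]
          have : ∑ u ∈ W.erase r, c u (Function.update par v s u)
              = ∑ u ∈ W.erase r, c u (par u) := by
            refine Finset.sum_congr rfl fun u hu => ?_
            rw [Function.update_of_ne (hneW u (Finset.mem_of_mem_erase hu))]
          rw [this, hc v s]
          have : m = c s v := by rw [hm, min_eq_left hadd.2]
          linarith
        · refine ⟨W, par, rk, hWA.trans (Finset.erase_subset _ _), hT, ?_⟩
          have e5 : ∑ a ∈ A \ W, p a = ∑ a ∈ A.erase v \ W, p a + p v := by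
            rw [← Finset.sum_erase_add (A \ W) p (Finset.mem_sdiff.2 ⟨hvA, hvW⟩),
              Finset.erase_sdiff_comm]
          rw [e5]
          by_cases hsW : s ∈ W
          · have : m = p v := by
              rw [hm, min_eq_right]
              by_contra h
              exact hadd ⟨hsW, (not_le.1 h).le⟩
            linarith
          · rw [if_neg hsW] at hbound
            linarith

end RootedTree

section PerfectMatching

/-- A symmetric weighting with row sums one whose odd cuts all have weight at least one contains a
perfect matching in its support. -/
theorem exists_matching_in_support {V : Type*} [Fintype V] [DecidableEq V] {z : V → V → ℝ}
    (hs : ∀ a b, z a b = z b a) (h0 : ∀ a b, 0 ≤ z a b) (hd : ∀ a, z a a = 0)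
    (hrow : ∀ a, ∑ b, z a b = 1) (hodd : ∀ X : Finset V, Odd X.card → 1 ≤ cutVal z X) :
    ∃ σ : V → V, ∀ a, σ (σ a) = a ∧ 0 < z a (σ a) := by
  classical
  let G : SimpleGraph V :=
    { Adj := fun a b => 0 < z a b
      symm := ⟨fun a b h => by rwa [hs]⟩
      loopless := ⟨fun a h => by rw [hd] at h; exact lt_irrefl _ h⟩ }
  obtain ⟨M, hM⟩ : ∃ M : G.Subgraph, M.IsPerfectMatching := by
    rw [SimpleGraph.tutte]
    intro u hu
    unfold SimpleGraph.IsTutteViolator at hu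
    set H := ((⊤ : G.Subgraph).deleteVerts u).coe with hH
    let comp : H.ConnectedComponent → Finset V := fun K =>
      Finset.univ.filter fun a => a ∈ Subtype.val '' K.supp
    have hcard : ∀ K, (comp K).card = K.supp.ncard := fun K => by
      rw [← Set.ncard_image_of_injective _ Subtype.val_injective, ← Set.ncard_coe_finset]
      congr 1
      ext a
      simp [comp]
    have hu' : ∀ K, ∀ a ∈ comp K, a ∉ u := by
      intro K a ha
      simp only [comp, Finset.mem_filter, Set.mem_image] at ha
      obtain ⟨-, w, -, rfl⟩ := ha
      have := w.2
      simpa using this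
    have hzero : ∀ K, ∀ a ∈ comp K, ∀ b ∉ comp K, b ∉ u → z a b = 0 := by
      intro K a ha b hb hbu
      by_contra hne
      have hpos : 0 < z a b := lt_of_le_of_ne (h0 a b) (Ne.symm hne)
      have hau := hu' K a ha
      simp only [comp, Finset.mem_filter, Finset.mem_univ, true_and, Set.mem_image] at ha hb
      obtain ⟨w, hw, rfl⟩ := ha
      apply hb
      have hbv : b ∈ ((⊤ : G.Subgraph).deleteVerts u).verts := by simpa using hbu
      refine ⟨⟨b, hbv⟩, ?_, rfl⟩
      rw [SimpleGraph.ConnectedComponent.mem_supp_iff] at hw ⊢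
      rw [← hw]
      refine (SimpleGraph.ConnectedComponent.sound (SimpleGraph.Adj.reachable ?_)).symm
      rw [hH, SimpleGraph.Subgraph.coe_adj, SimpleGraph.Subgraph.deleteVerts_adj]
      exact ⟨trivial, hau, trivial, hbu, hpos⟩
    have hdisj : ∀ K L, K ≠ L → Disjoint (comp K) (comp L) := by
      intro K L hKL
      rw [Finset.disjoint_left]
      intro a ha hb
      simp only [comp, Finset.mem_filter, Finset.mem_univ, true_and, Set.mem_image] at ha hb
      obtain ⟨w, hw, rfl⟩ := ha
      obtain ⟨w', hw', e⟩ := hb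
      rw [Subtype.val_injective e] at hw'
      rw [SimpleGraph.ConnectedComponent.mem_supp_iff] at hw hw'
      exact hKL (hw.symm.trans hw')
    let T : Finset H.ConnectedComponent := (Set.toFinite H.oddComponents).toFinset
    let U : Finset V := Finset.univ.filter fun a => a ∈ u
    have hU : U.card = u.ncard := by
      rw [← Set.ncard_coe_finset]; congr 1; ext a; simp [U]
    have hT : T.card = H.oddComponents.ncard := by
      rw [← Set.ncard_coe_finset]; congr 1; simp [T]
    rw [← hU, ← hT] at hu
    have h1 : (T.card : ℝ) ≤ ∑ K ∈ T, ∑ a ∈ comp K, ∑ b ∈ U, z a b := by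
      rw [Finset.card_eq_sum_ones, Nat.cast_sum]
      refine Finset.sum_le_sum fun K hK => ?_
      have hoK : Odd (comp K).card := by
        rw [hcard]; simpa [T] using hK
      refine (Nat.cast_one.le.trans (hodd _ hoK)).trans ?_
      unfold cutVal
      refine Finset.sum_le_sum fun a ha => ?_
      have : U ⊆ (comp K)ᶜ := fun b hb => by
        rw [Finset.mem_compl]
        exact fun h => hu' K b h (by simpa [U] using hb)
      rw [← Finset.sum_subset this]
      intro b hb hbU
      exact hzero K a ha b (by simpa using hb) (by simpa [U] using hbU)
    have h2 : ∑ K ∈ T, ∑ a ∈ comp K, ∑ b ∈ U, z a b ≤ ∑ a, ∑ b ∈ U, z a b := by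
      rw [← Finset.sum_biUnion (fun K _ L _ h => hdisj K L h)]
      exact Finset.sum_le_sum_of_subset_of_nonneg (Finset.subset_univ _)
        fun a _ _ => Finset.sum_nonneg fun b _ => h0 a b
    have h3 : ∑ a, ∑ b ∈ U, z a b = U.card := by
      rw [Finset.sum_comm]
      rw [Finset.card_eq_sum_ones, Nat.cast_sum]
      refine Finset.sum_congr rfl fun b _ => ?_
      rw [Nat.cast_one, ← hrow b]
      exact Finset.sum_congr rfl fun a _ => hs _ _
    have h4 : (T.card : ℝ) ≤ U.card := h1.trans (h2.trans h3.le)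
    have := Nat.cast_le.mp h4
    omega
  rw [SimpleGraph.Subgraph.isPerfectMatching_iff] at hM
  choose σ hσ hσu using hM
  exact ⟨σ, fun a => ⟨(hσu (σ a) a (hσ a).symm).symm, (hσ a).adj_sub⟩⟩

end PerfectMatching

section FractionalMatching

variable {V : Type*} [DecidableEq V]

/-- `z` is a fractional perfect matching of `A` satisfying the odd cut constraints. -/
structure IsFracMatching (A : Finset V) (z : V → V → ℝ) : Prop where
  symm : ∀ a b, z a b = z b a
  nonneg : ∀ a b, 0 ≤ z a b
  diag : ∀ a, z a a = 0
  supp : ∀ a b, a ∉ A → z a b = 0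
  row : ∀ a ∈ A, ∑ b ∈ A, z a b = 1
  odd : ∀ X ⊆ A, Odd X.card → 1 ≤ ∑ a ∈ X, ∑ b ∈ A \ X, z a b

/-- `σ` restricts to a fixed point free involution of `A`. -/
def IsMatchingOn (A : Finset V) (σ : V → V) : Prop :=
  ∀ a ∈ A, σ a ∈ A ∧ σ a ≠ a ∧ σ (σ a) = a

theorem IsFracMatching.exists_support {A : Finset V} {z : V → V → ℝ} (hz : IsFracMatching A z) :
    ∃ σ, IsMatchingOn A σ ∧ ∀ a ∈ A, 0 < z a (σ a) := by
  obtain ⟨σ, hσ⟩ := exists_matching_in_support (V := A) (z := fun a b => z a b)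
    (fun a b => hz.symm a b) (fun a b => hz.nonneg a b) (fun a => hz.diag a)
    (fun a => by
      rw [← hz.row a a.2]
      exact Finset.sum_coe_sort A (fun b => z a b))
    (fun X hX => by
      have := hz.odd (X.map (Function.Embedding.subtype _)) (fun a ha => by
        simp only [Finset.mem_map, Function.Embedding.subtype_apply] at ha
        obtain ⟨b, -, rfl⟩ := ha
        exact b.2) (by rwa [Finset.card_map])
      refine this.trans (le_of_eq ?_)
      unfold cutVal
      rw [Finset.sum_map]
      refine Finset.sum_congr rfl fun a _ => ?_
      have e : A \ X.map (Function.Embedding.subtype _) =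
          (Xᶜ).map (Function.Embedding.subtype (· ∈ A)) := by
        ext b
        simp only [Finset.mem_sdiff, Finset.mem_map, Function.Embedding.subtype_apply,
          Finset.mem_compl, Subtype.exists, exists_and_right, exists_eq_right]
        constructor
        · rintro ⟨h1, h2⟩
          exact ⟨h1, fun h => h2 ⟨h1, h⟩⟩
        · rintro ⟨h1, h2⟩
          exact ⟨h1, fun ⟨_, h⟩ => h2 h⟩
      rw [e, Finset.sum_map]
      rfl)
  refine ⟨fun a => if h : a ∈ A then σ ⟨a, h⟩ else a, fun a ha => ?_, fun a ha => ?_⟩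
  · have h1 := (hσ ⟨a, ha⟩).2
    have h2 := (hσ ⟨a, ha⟩).1
    simp only [ha, dite_true, (σ ⟨a, ha⟩).2, Subtype.coe_eta, h2]
    refine ⟨trivial, fun e => ?_, trivial⟩
    rw [e, hz.diag] at h1
    exact lt_irrefl _ h1
  · simpa [ha] using (hσ ⟨a, ha⟩).2

theorem IsFracMatching.cut_comm {A X : Finset V} {z : V → V → ℝ} (hz : IsFracMatching A z)
    (hX : X ⊆ A) :
    ∑ a ∈ A \ X, ∑ b ∈ A \ (A \ X), z a b = ∑ a ∈ X, ∑ b ∈ A \ X, z a b := by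
  rw [Finset.sdiff_sdiff_eq_self hX, Finset.sum_comm]
  exact Finset.sum_congr rfl fun a _ => Finset.sum_congr rfl fun b _ => hz.symm _ _

theorem IsFracMatching.even_card {A : Finset V} {z : V → V → ℝ} (hz : IsFracMatching A z) :
    Even A.card := by
  by_contra h
  have := hz.odd A subset_rfl (Nat.not_even_iff_odd.mp h)
  simp at this
  linarith

/-- The weighting obtained by contracting `T` to the single vertex `s`. -/
def contractTo (z : V → V → ℝ) (S T : Finset V) (s : V) (a b : V) : ℝ :=
  if a ∈ S then (if b ∈ S then z a b else if b = s then ∑ w ∈ T, z a w else 0)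
  else if a = s ∧ b ∈ S then ∑ w ∈ T, z b w else 0

theorem IsFracMatching.contractTo {A S : Finset V} {z : V → V → ℝ} (hz : IsFracMatching A z)
    (hS : S ⊆ A) (hodd : Odd S.card) (hcut : ∑ a ∈ S, ∑ b ∈ A \ S, z a b = 1) {s : V}
    (hs : s ∉ S) : IsFracMatching (insert s S) (contractTo z S (A \ S) s) := by
  have hsymm : ∀ a b, _root_.contractTo z S (A \ S) s a b =
      _root_.contractTo z S (A \ S) s b a := fun a b => by
    unfold _root_.contractTo
    by_cases ha : a ∈ S <;> by_cases hb : b ∈ S <;> simp [ha, hb, hz.symm a b]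
  have hne : ∀ a ∈ S, a ≠ s := fun a ha e => hs (e ▸ ha)
  have hcutlow : ∀ X ⊆ S, ∑ a ∈ X, ∑ b ∈ insert s S \ X, _root_.contractTo z S (A \ S) s a b =
      ∑ a ∈ X, ∑ b ∈ A \ X, z a b := by
    intro X hX
    refine Finset.sum_congr rfl fun a ha => ?_
    have haS := hX ha
    have hsX : s ∉ X := fun h => hs (hX h)
    rw [Finset.insert_sdiff_of_notMem _ hsX, Finset.sum_insert (by simp [hs])]
    have e : A \ X = (A \ S) ∪ (S \ X) := by
      ext b
      simp only [Finset.mem_sdiff, Finset.mem_union]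
      constructor
      · rintro ⟨h1, h2⟩
        by_cases h : b ∈ S <;> simp [h, h1, h2]
      · rintro (⟨h1, h2⟩ | ⟨h1, h2⟩)
        · exact ⟨h1, fun h => h2 (hX h)⟩
        · exact ⟨hS h1, h2⟩
    rw [e, Finset.sum_union (Finset.disjoint_left.mpr fun b hb hb' => by
      simp only [Finset.mem_sdiff] at hb hb'; exact hb.2 hb'.1)]
    congr 1
    · simp [_root_.contractTo, haS, hs]
    · refine Finset.sum_congr rfl fun b hb => ?_
      simp [_root_.contractTo, haS, (Finset.mem_sdiff.mp hb).1]
  refine ⟨hsymm, fun a b => ?_, fun a => ?_, fun a b ha => ?_, fun a ha => ?_, fun X hX hXo => ?_⟩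
  · unfold _root_.contractTo
    have := hz.nonneg
    have h1 := fun a => Finset.sum_nonneg (s := A \ S) (fun w _ => hz.nonneg a w)
    split_ifs <;> first | exact hz.nonneg _ _ | exact h1 _ | exact le_rfl
  · unfold _root_.contractTo
    by_cases ha : a ∈ S <;> simp [ha, hz.diag]
  · simp only [Finset.mem_insert, not_or] at ha
    simp [_root_.contractTo, ha]
  · rw [Finset.sum_insert hs]
    rcases Finset.mem_insert.mp ha with rfl | haS
    · rw [← hcut]
      simp only [_root_.contractTo, hs, if_false, and_false, zero_add, true_and]
      exact Finset.sum_congr rfl fun b hb => by simp [hb]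
    · rw [← hz.row a (hS haS), ← Finset.sum_sdiff hS]
      congr 1
      · simp [_root_.contractTo, haS, hs]
      · exact Finset.sum_congr rfl fun b hb => by simp [_root_.contractTo, haS, hb]
  · by_cases hsX : s ∈ X
    · set Y := insert s S \ X with hY
      have hYS : Y ⊆ S := fun b hb => by
        simp only [hY, Finset.mem_sdiff, Finset.mem_insert] at hb
        rcases hb with ⟨rfl | h, h2⟩
        · exact absurd hsX h2
        · exact h
      have hYX : insert s S \ Y = X := Finset.sdiff_sdiff_eq_self hX
      have hYo : Odd Y.card := by
        rw [hY, Finset.card_sdiff_of_subset hX, Finset.card_insert_of_notMem hs]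
        have h1 := Finset.card_le_card hX
        rw [Finset.card_insert_of_notMem hs] at h1
        obtain ⟨k, hk⟩ := hodd
        obtain ⟨l, hl⟩ := hXo
        exact ⟨k - l, by omega⟩
      refine (hz.odd Y (hYS.trans hS) hYo).trans (le_of_eq ?_)
      rw [← hcutlow Y hYS, hYX, Finset.sum_comm]
      exact Finset.sum_congr rfl fun a _ => Finset.sum_congr rfl fun b _ => hsymm _ _
    · have hXS : X ⊆ S := fun b hb =>
        (Finset.mem_insert.mp (hX hb)).resolve_left fun h => hsX (h ▸ hb)
      rw [hcutlow X hXS]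
      exact hz.odd X (hXS.trans hS) hXo

/-- A matching of the contracted graph is a near-perfect matching of `S` missing one vertex `u`,
which is matched to the outside at cost `h u`. -/
theorem exists_near_matching {A S : Finset V} {z : V → V → ℝ} {s : V} (hs : s ∉ S)
    (ih : ∀ c : V → V → ℝ, (∀ a b, c a b = c b a) → ∃ σ, IsMatchingOn (insert s S) σ ∧
      ∑ a ∈ insert s S, c a (σ a) ≤
        ∑ a ∈ insert s S, ∑ b ∈ insert s S, c a b * contractTo z S (A \ S) s a b)
    (c : V → V → ℝ) (hc : ∀ a b, c a b = c b a) (h : V → ℝ) :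
    ∃ u ∈ S, ∃ σ, IsMatchingOn (S.erase u) σ ∧
      ∑ a ∈ S.erase u, c a (σ a) + 2 * h u ≤
        ∑ a ∈ S, ∑ b ∈ S, c a b * z a b + 2 * ∑ a ∈ S, h a * ∑ w ∈ A \ S, z a w := by
  obtain ⟨σ, hσ, hle⟩ := ih (fun a b => if a = s then h b else if b = s then h a else c a b)
    (fun a b => by
      by_cases ha : a = s <;> by_cases hb : b = s <;> simp [ha, hb, hc a b])
  have hne : ∀ a ∈ S, a ≠ s := fun a ha e => hs (e ▸ ha)
  obtain ⟨h1, h2, h3⟩ := hσ s (Finset.mem_insert_self _ _)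
  have hu : σ s ∈ S := (Finset.mem_insert.mp h1).resolve_left h2
  have hmem : ∀ a ∈ S.erase (σ s), σ a ∈ S.erase (σ s) := fun a ha => by
    obtain ⟨hau, haS⟩ := Finset.mem_erase.mp ha
    obtain ⟨g1, g2, g3⟩ := hσ a (Finset.mem_insert_of_mem haS)
    refine Finset.mem_erase.mpr ⟨fun e => ?_, (Finset.mem_insert.mp g1).resolve_left fun e => ?_⟩
    · rw [e, h3] at g3
      exact hne a haS g3.symm
    · rw [e] at g3
      exact hau g3.symm
  refine ⟨σ s, hu, σ, fun a ha => ⟨hmem a ha, ?_⟩, ?_⟩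
  · exact (hσ a (Finset.mem_insert_of_mem (Finset.mem_of_mem_erase ha))).2
  · refine le_trans (le_of_eq ?_) (hle.trans (le_of_eq ?_))
    · rw [Finset.sum_insert hs, ← Finset.add_sum_erase S _ hu, if_pos rfl, if_neg h2, if_pos h3]
      have : ∀ a ∈ S.erase (σ s), (if a = s then h (σ a) else if σ a = s then h a else c a (σ a)) =
          c a (σ a) := fun a ha => by
        rw [if_neg (hne a (Finset.mem_of_mem_erase ha)),
          if_neg (hne _ (Finset.mem_of_mem_erase (hmem a ha)))]
      rw [Finset.sum_congr rfl this]
      ring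
    · rw [Finset.sum_insert hs, Finset.sum_insert hs]
      have e1 : ∀ b ∈ S, (if s = s then h b else if b = s then h s else c s b) *
          contractTo z S (A \ S) s s b = h b * ∑ w ∈ A \ S, z b w := fun b hb => by
        simp [contractTo, hs, hb]
      have e2 : ∀ a ∈ S, ∑ b ∈ insert s S, (if a = s then h b else if b = s then h a else c a b) *
          contractTo z S (A \ S) s a b =
            h a * ∑ w ∈ A \ S, z a w + ∑ b ∈ S, c a b * z a b := fun a ha => by
        rw [Finset.sum_insert hs]
        congr 1
        · simp [contractTo, hs, ha, hne a ha]
        · exact Finset.sum_congr rfl fun b hb => by simp [contractTo, ha, hb, hne a ha, hne b hb]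
      rw [Finset.sum_congr rfl e1, Finset.sum_congr rfl e2, Finset.sum_add_distrib]
      simp [contractTo, hs]
      ring

/-- Gluing near-perfect matchings of both sides of a tight odd cut. -/
theorem exists_matching_of_near_matchings [Finite V] {A S : Finset V} {z : V → V → ℝ}
    (hz : IsFracMatching A z) (hS : S ⊆ A)
    (h₁ : ∀ c : V → V → ℝ, (∀ a b, c a b = c b a) → ∀ h : V → ℝ,
      ∃ u ∈ S, ∃ σ, IsMatchingOn (S.erase u) σ ∧
        ∑ a ∈ S.erase u, c a (σ a) + 2 * h u ≤
          ∑ a ∈ S, ∑ b ∈ S, c a b * z a b + 2 * ∑ a ∈ S, h a * ∑ w ∈ A \ S, z a w)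
    (h₂ : ∀ c : V → V → ℝ, (∀ a b, c a b = c b a) → ∀ h : V → ℝ,
      ∃ w ∈ A \ S, ∃ σ, IsMatchingOn ((A \ S).erase w) σ ∧
        ∑ a ∈ (A \ S).erase w, c a (σ a) + 2 * h w ≤
          ∑ a ∈ A \ S, ∑ b ∈ A \ S, c a b * z a b + 2 * ∑ b ∈ A \ S, h b * ∑ a ∈ S, z b a)
    (c : V → V → ℝ) (hc : ∀ a b, c a b = c b a) :
    ∃ σ, IsMatchingOn A σ ∧ ∑ a ∈ A, c a (σ a) ≤ ∑ a ∈ A, ∑ b ∈ A, c a b * z a b := by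
  classical
  set g : V → ℝ := fun a => ∑ w ∈ A \ S, z a w with hg
  have hg0 : ∀ a, 0 ≤ g a := fun a => Finset.sum_nonneg fun b _ => hz.nonneg a b
  have hex : ∀ u ∈ S, g u ≠ 0 → ∃ σ, IsMatchingOn (S.erase u) σ := by
    intro u hu hgu
    obtain ⟨v, hv, σ, hσ, hle⟩ := h₁ (fun _ _ => 0) (fun _ _ => rfl)
      (fun a => if a = u then -1 else 0)
    by_cases hvu : v = u
    · exact ⟨σ, hvu ▸ hσ⟩
    · exfalso
      have e : ∑ a ∈ S, (if a = u then (-1 : ℝ) else 0) * ∑ w ∈ A \ S, z a w = - g u := by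
        rw [Finset.sum_eq_single u (fun b _ hb => by simp [hb]) (fun h => absurd hu h)]
        simp [hg]
      rw [e] at hle
      simp only [zero_mul, Finset.sum_const_zero, if_neg hvu] at hle
      have := lt_of_le_of_ne (hg0 u) (Ne.symm hgu)
      linarith
  have hbest : ∀ u, ∃ σ, (∃ σ', IsMatchingOn (S.erase u) σ') → IsMatchingOn (S.erase u) σ ∧
      ∀ τ, IsMatchingOn (S.erase u) τ → ∑ a ∈ S.erase u, c a (σ a) ≤ ∑ a ∈ S.erase u, c a (τ a) := by
    intro u
    by_cases hu : ∃ σ', IsMatchingOn (S.erase u) σ'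
    · obtain ⟨σ, h1, h2⟩ := Set.exists_min_image {σ | IsMatchingOn (S.erase u) σ}
        (fun σ => ∑ a ∈ S.erase u, c a (σ a)) (Set.toFinite _) hu
      exact ⟨σ, fun _ => ⟨h1, h2⟩⟩
    · exact ⟨id, fun h => absurd h hu⟩
  choose σ hσ using hbest
  set f : V → ℝ := fun u => ∑ a ∈ S.erase u, c a (σ u a) with hf
  set I₁ := ∑ a ∈ S, ∑ b ∈ S, c a b * z a b with hI₁
  set I₂ := ∑ a ∈ A \ S, ∑ b ∈ A \ S, c a b * z a b with hI₂
  have hfg : ∑ u ∈ S, f u * g u ≤ I₁ := by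
    obtain ⟨v, hv, τ, hτ, hle⟩ := h₁ c hc (fun u => - f u / 2)
    have h1 := (hσ v ⟨τ, hτ⟩).2 τ hτ
    have e : ∑ a ∈ S, -f a / 2 * ∑ w ∈ A \ S, z a w = - (∑ u ∈ S, f u * g u) / 2 := by
      rw [← Finset.sum_neg_distrib, Finset.sum_div]
      exact Finset.sum_congr rfl fun a _ => by simp only [hg]; ring
    rw [e] at hle
    linarith
  set U := S.filter fun u => ∃ σ', IsMatchingOn (S.erase u) σ' with hU
  have hUne : U.Nonempty := by
    obtain ⟨v, hv, τ, hτ, -⟩ := h₁ c hc 0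
    exact ⟨v, Finset.mem_filter.mpr ⟨hv, τ, hτ⟩⟩
  have hmin : ∀ w, ∃ u ∈ U, ∀ u' ∈ U, c u w + f u / 2 ≤ c u' w + f u' / 2 := fun w =>
    Finset.exists_min_image U _ hUne
  choose m hmU hm using hmin
  obtain ⟨w, hw, τ, hτ, hle⟩ := h₂ c hc (fun w => c (m w) w + f (m w) / 2)
  have hcross : ∑ b ∈ A \ S, (c (m b) b + f (m b) / 2) * ∑ a ∈ S, z b a ≤
      ∑ a ∈ S, ∑ b ∈ A \ S, c a b * z a b + I₁ / 2 := by
    calc _ = ∑ b ∈ A \ S, ∑ a ∈ S, (c (m b) b + f (m b) / 2) * z a b :=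
          Finset.sum_congr rfl fun b _ => by
            rw [Finset.mul_sum]
            exact Finset.sum_congr rfl fun a _ => by rw [hz.symm]
      _ ≤ ∑ b ∈ A \ S, ∑ a ∈ S, (c a b + f a / 2) * z a b := by
          refine Finset.sum_le_sum fun b hb => Finset.sum_le_sum fun a ha => ?_
          by_cases hab : z a b = 0
          · simp [hab]
          · refine mul_le_mul_of_nonneg_right (hm b a (Finset.mem_filter.mpr ⟨ha, ?_⟩))
              (hz.nonneg a b)
            refine hex a ha fun h => hab ?_
            rw [hg] at h
            exact (Finset.sum_eq_zero_iff_of_nonneg (fun b _ => hz.nonneg a b)).mp h b hb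
      _ = ∑ a ∈ S, ∑ b ∈ A \ S, c a b * z a b + (∑ u ∈ S, f u * g u) / 2 := by
          rw [Finset.sum_comm, Finset.sum_div, ← Finset.sum_add_distrib]
          refine Finset.sum_congr rfl fun a _ => ?_
          have e : f a * g a / 2 = ∑ b ∈ A \ S, f a / 2 * z a b := by
            simp only [hg]
            rw [← Finset.mul_sum]
            ring
          rw [e, ← Finset.sum_add_distrib]
          exact Finset.sum_congr rfl fun b _ => by ring
      _ ≤ _ := by linarith
  have huU := hmU w
  generalize m w = u at hle huU
  obtain ⟨huS, huex⟩ := Finset.mem_filter.mp huU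
  have hσu := (hσ u huex).1
  obtain ⟨hwA, hwS⟩ := Finset.mem_sdiff.mp hw
  have huw : u ≠ w := fun e => hwS (e ▸ huS)
  have hmS : ∀ a ∈ S, a ≠ u → σ u a ∈ S ∧ σ u a ≠ u ∧ σ u a ≠ a ∧ σ u (σ u a) = a :=
    fun a ha hau => by
      obtain ⟨g1, g2, g3⟩ := hσu a (Finset.mem_erase.mpr ⟨hau, ha⟩)
      exact ⟨Finset.mem_of_mem_erase g1, Finset.ne_of_mem_erase g1, g2, g3⟩
  have hmT : ∀ a ∈ A, a ∉ S → a ≠ w → τ a ∈ A ∧ τ a ∉ S ∧ τ a ≠ w ∧ τ a ≠ a ∧ τ (τ a) = a :=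
    fun a ha haS haw => by
      obtain ⟨g1, g2, g3⟩ := hτ a (Finset.mem_erase.mpr ⟨haw, Finset.mem_sdiff.mpr ⟨ha, haS⟩⟩)
      obtain ⟨g4, g5⟩ := Finset.mem_erase.mp g1
      obtain ⟨g6, g7⟩ := Finset.mem_sdiff.mp g5
      exact ⟨g6, g7, g4, g2, g3⟩
  refine ⟨fun a => if a ∈ S then (if a = u then w else σ u a) else (if a = w then u else τ a),
    fun a ha => ?_, ?_⟩
  · by_cases haS : a ∈ S
    · by_cases hau : a = u
      · simp [hau, huS, hwS, hwA, huw.symm]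
      · obtain ⟨g1, g2, g3, g4⟩ := hmS a haS hau
        simp [haS, hau, g1, g2, g3, g4, hS g1]
    · by_cases haw : a = w
      · simp [haw, hwS, huS, hS huS, huw]
      · obtain ⟨g1, g2, g3, g4, g5⟩ := hmT a ha haS haw
        simp [haS, haw, g1, g2, g3, g4, g5]
  · have eL : ∑ a ∈ A, c a (if a ∈ S then (if a = u then w else σ u a)
        else (if a = w then u else τ a)) =
        f u + ∑ a ∈ (A \ S).erase w, c a (τ a) + 2 * c u w := by
      rw [← Finset.sum_sdiff hS, ← Finset.add_sum_erase S _ huS, ← Finset.add_sum_erase _ _ hw]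
      have e1 : ∀ a ∈ S.erase u, c a (if a ∈ S then (if a = u then w else σ u a)
          else (if a = w then u else τ a)) = c a (σ u a) := fun a ha => by
        rw [if_pos (Finset.mem_of_mem_erase ha), if_neg (Finset.ne_of_mem_erase ha)]
      have e2 : ∀ a ∈ (A \ S).erase w, c a (if a ∈ S then (if a = u then w else σ u a)
          else (if a = w then u else τ a)) = c a (τ a) := fun a ha => by
        rw [if_neg (Finset.mem_sdiff.mp (Finset.mem_of_mem_erase ha)).2,
          if_neg (Finset.ne_of_mem_erase ha)]
      rw [Finset.sum_congr rfl e1, Finset.sum_congr rfl e2, if_pos huS, if_pos rfl, if_neg hwS,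
        if_pos rfl, hc w u]
      simp only [hf]
      ring
    have eR : ∑ a ∈ A, ∑ b ∈ A, c a b * z a b =
        I₁ + I₂ + 2 * ∑ a ∈ S, ∑ b ∈ A \ S, c a b * z a b := by
      have e3 : ∑ a ∈ A \ S, ∑ b ∈ S, c a b * z a b = ∑ a ∈ S, ∑ b ∈ A \ S, c a b * z a b := by
        rw [Finset.sum_comm]
        exact Finset.sum_congr rfl fun a _ => Finset.sum_congr rfl fun b _ => by
          rw [hc, hz.symm]
      rw [← Finset.sum_sdiff hS]
      simp only [← Finset.sum_sdiff hS (f := fun b => c _ b * z _ b)]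
      rw [Finset.sum_add_distrib, Finset.sum_add_distrib, e3]
      ring
    rw [eL, eR]
    linarith

theorem isCompact_isFracMatching (A : Finset V) : IsCompact {z | IsFracMatching A z} := by
  have hcl : IsClosed {z : V → V → ℝ | IsFracMatching A z} := by
    have e : {z : V → V → ℝ | IsFracMatching A z} =
        {z | (∀ a b, z a b = z b a) ∧ (∀ a b, 0 ≤ z a b) ∧ (∀ a, z a a = 0) ∧
          (∀ a b, a ∉ A → z a b = 0) ∧ (∀ a ∈ A, ∑ b ∈ A, z a b = 1) ∧
          ∀ X ⊆ A, Odd X.card → 1 ≤ ∑ a ∈ X, ∑ b ∈ A \ X, z a b} := by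
      ext z
      exact ⟨fun h => ⟨h.1, h.2, h.3, h.4, h.5, h.6⟩,
        fun ⟨h1, h2, h3, h4, h5, h6⟩ => ⟨h1, h2, h3, h4, h5, h6⟩⟩
    rw [e]
    simp only [Set.ofPred_and, Set.ofPred_forall]
    refine IsClosed.inter (isClosed_iInter fun a => isClosed_iInter fun b => ?_)
      (IsClosed.inter (isClosed_iInter fun a => isClosed_iInter fun b => ?_)
      (IsClosed.inter (isClosed_iInter fun a => ?_)
      (IsClosed.inter (isClosed_iInter fun a => isClosed_iInter fun b => isClosed_iInter fun _ => ?_)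
      (IsClosed.inter (isClosed_iInter fun a => isClosed_iInter fun _ => ?_)
      (isClosed_iInter fun X => isClosed_iInter fun _ => isClosed_iInter fun _ => ?_)))))
    · exact isClosed_eq (by fun_prop) (by fun_prop)
    · exact isClosed_le (by fun_prop) (by fun_prop)
    · exact isClosed_eq (by fun_prop) (by fun_prop)
    · exact isClosed_eq (by fun_prop) (by fun_prop)
    · exact isClosed_eq (by fun_prop) (by fun_prop)
    · exact isClosed_le (by fun_prop) (by fun_prop)
  refine IsCompact.of_isClosed_subset (isCompact_univ_pi fun _ : V => isCompact_univ_pi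
    fun _ : V => isCompact_Icc (a := (0 : ℝ)) (b := 1)) hcl ?_
  intro z hz a _ b _
  refine ⟨hz.nonneg a b, ?_⟩
  by_cases ha : a ∈ A
  · by_cases hb : b ∈ A
    · rw [← hz.row a ha]
      exact Finset.single_le_sum (f := fun b => z a b) (fun b _ => hz.nonneg a b) hb
    · rw [hz.symm, hz.supp b a hb]; exact zero_le_one
  · rw [hz.supp a b ha]; exact zero_le_one

/-- Moving a fractional matching away from a matching in its support. -/
theorem IsFracMatching.exists_move {A : Finset V} {z : V → V → ℝ} (hz : IsFracMatching A z)
    (hA : ∀ S ⊆ A, Odd S.card → 1 < S.card → S.card + 1 < A.card →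
      ∑ a ∈ S, ∑ b ∈ A \ S, z a b ≠ 1)
    {σ : V → V} (hσ : IsMatchingOn A σ) (hpos : ∀ a ∈ A, 0 < z a (σ a)) :
    ∃ ε > 0, IsFracMatching A fun a b =>
      (1 + ε) * z a b - if a ∈ A ∧ b = σ a then ε else 0 := by
  have hev : ∀ᶠ ε in nhdsWithin (0 : ℝ) (Set.Ioi 0), (∀ a ∈ A, ε ≤ z a (σ a)) ∧
      ∀ S ∈ A.powerset, Odd S.card → 1 < S.card → S.card + 1 < A.card →
        ε * A.card ≤ ∑ a ∈ S, ∑ b ∈ A \ S, z a b - 1 := by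
    refine Filter.Eventually.and ?_ ?_
    · rw [Filter.eventually_all_finset]
      intro a ha
      exact mem_nhdsWithin_of_mem_nhds (Iic_mem_nhds (hpos a ha))
    · rw [Filter.eventually_all_finset]
      intro S hS
      by_cases h : Odd S.card ∧ 1 < S.card ∧ S.card + 1 < A.card
      · have hS' := Finset.mem_powerset.mp hS
        have h1 : 0 < ∑ a ∈ S, ∑ b ∈ A \ S, z a b - 1 :=
          sub_pos.mpr (lt_of_le_of_ne (hz.odd S hS' h.1) (hA S hS' h.1 h.2.1 h.2.2).symm)
        have h2 : Filter.Tendsto (fun ε : ℝ => ε * A.card) (nhds 0) (nhds 0) := by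
          have : Continuous fun ε : ℝ => ε * A.card := by fun_prop
          simpa using this.tendsto 0
        have h3 := mem_nhdsWithin_of_mem_nhds (t := Set.Ioi (0 : ℝ)) (h2 (Iic_mem_nhds h1))
        filter_upwards [h3] with ε hε _ _ _
        exact hε
      · exact Filter.Eventually.of_forall fun ε h1 h2 h3 => absurd ⟨h1, h2, h3⟩ h
  obtain ⟨ε, ⟨hε1, hε2⟩, hε⟩ := (hev.and self_mem_nhdsWithin).exists
  replace hε : 0 < ε := hε
  set w : V → V → ℝ := fun a b => (1 + ε) * z a b - if a ∈ A ∧ b = σ a then ε else 0 with hw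
  have hsw : ∀ a b, w a b = w b a := fun a b => by
    have : (a ∈ A ∧ b = σ a) ↔ (b ∈ A ∧ a = σ b) :=
      ⟨fun ⟨h1, h2⟩ => by subst h2; exact ⟨(hσ a h1).1, (hσ a h1).2.2.symm⟩,
        fun ⟨h1, h2⟩ => by subst h2; exact ⟨(hσ b h1).1, (hσ b h1).2.2.symm⟩⟩
    simp only [hw, hz.symm a b, this]
  have hrow : ∀ a ∈ A, ∑ b ∈ A, w a b = 1 := fun a ha => by
    simp only [hw, Finset.sum_sub_distrib, ← Finset.mul_sum, hz.row a ha, ha, true_and]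
    rw [Finset.sum_ite_eq' A (σ a), if_pos (hσ a ha).1]
    ring
  have hdiag : ∀ a, w a a = 0 := fun a => by
    have : ¬(a ∈ A ∧ a = σ a) := fun ⟨h1, h2⟩ => (hσ a h1).2.1 h2.symm
    simp [hw, hz.diag, this]
  have hsing : ∀ a ∈ A, ∑ b ∈ A \ {a}, w a b = 1 := fun a ha => by
    rw [← hrow a ha, ← Finset.add_sum_erase A _ ha, hdiag, zero_add, Finset.sdiff_singleton_eq_erase]
  refine ⟨ε, hε, hsw, fun a b => ?_, hdiag, fun a b ha => ?_, hrow, fun X hX hXo => ?_⟩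
  · have := hz.nonneg a b
    split_ifs with h
    · have h1 := hε1 a h.1
      rw [← h.2] at h1
      nlinarith
    · nlinarith
  · simp [ha, hz.supp a b ha]
  · by_cases h1 : X.card = 1
    · obtain ⟨a, rfl⟩ := Finset.card_eq_one.mp h1
      rw [Finset.sum_singleton, hsing a (hX (Finset.mem_singleton_self a))]
    · have hle := Finset.card_le_card hX
      obtain ⟨k, hk⟩ := hXo
      obtain ⟨l, hl⟩ := hz.even_card
      by_cases h2 : X.card + 1 < A.card
      · have h3 := hε2 X (Finset.mem_powerset.mpr hX) ⟨k, hk⟩ (by omega) h2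
        have h4 : ∑ a ∈ X, ∑ b ∈ A \ X, w a b = (1 + ε) * ∑ a ∈ X, ∑ b ∈ A \ X, z a b -
            ∑ a ∈ X, ∑ b ∈ A \ X, if a ∈ A ∧ b = σ a then ε else 0 := by
          simp only [hw, Finset.sum_sub_distrib, ← Finset.mul_sum]
        have h5 : ∑ a ∈ X, ∑ b ∈ A \ X, (if a ∈ A ∧ b = σ a then ε else 0) ≤ ε * A.card := by
          calc _ ≤ ∑ a ∈ X, ε := Finset.sum_le_sum fun a ha => by
                simp only [hX ha, true_and]
                rw [Finset.sum_ite_eq' (A \ X) (σ a)]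
                split_ifs <;> linarith
            _ = X.card * ε := by rw [Finset.sum_const, nsmul_eq_mul]
            _ ≤ A.card * ε := by gcongr
            _ = _ := mul_comm _ _
        have h6 := hz.odd X hX ⟨k, hk⟩
        rw [h4]
        nlinarith
      · have h3 : (A \ X).card = 1 := by
          rw [Finset.card_sdiff_of_subset hX]; omega
        obtain ⟨a, ha⟩ := Finset.card_eq_one.mp h3
        have haA : a ∈ A := (Finset.mem_sdiff.mp (ha ▸ Finset.mem_singleton_self a)).1
        rw [Finset.sum_comm, ha, Finset.sum_singleton]
        have e : X = A \ {a} := by rw [← ha, Finset.sdiff_sdiff_eq_self hX]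
        refine (hsing a haA).ge.trans ?_
        rw [← e]
        exact Finset.sum_le_sum fun b _ => (hsw a b).le

/-- Edmonds' perfect matching polytope theorem. -/
theorem IsFracMatching.exists_matching [Finite V] (n : ℕ) : ∀ (A : Finset V), A.card = n →
    ∀ (z : V → V → ℝ), IsFracMatching A z → ∀ (c : V → V → ℝ), (∀ a b, c a b = c b a) →
      ∃ σ, IsMatchingOn A σ ∧ ∑ a ∈ A, c a (σ a) ≤ ∑ a ∈ A, ∑ b ∈ A, c a b * z a b := by
  induction n using Nat.strong_induction_on with
  | _ n ih =>
    intro A hAn z₀ hz₀ c hc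
    obtain ⟨z, hz, hmin⟩ := (isCompact_isFracMatching A).exists_isMinOn ⟨z₀, hz₀⟩
      (f := fun z => ∑ a ∈ A, ∑ b ∈ A, c a b * z a b) (Continuous.continuousOn (by fun_prop))
    replace hz : IsFracMatching A z := hz
    have hle := hmin hz₀
    suffices h : ∃ σ, IsMatchingOn A σ ∧ ∑ a ∈ A, c a (σ a) ≤ ∑ a ∈ A, ∑ b ∈ A, c a b * z a b by
      obtain ⟨σ, h1, h2⟩ := h
      exact ⟨σ, h1, h2.trans hle⟩
    by_cases hA : ∀ S ⊆ A, Odd S.card → 1 < S.card → S.card + 1 < A.card →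
      ∑ a ∈ S, ∑ b ∈ A \ S, z a b ≠ 1
    · obtain ⟨σ, hσ, hpos⟩ := hz.exists_support
      obtain ⟨ε, hε, hz'⟩ := hz.exists_move hA hσ hpos
      have h := hmin hz'
      simp only [Set.mem_ofPred_eq] at h
      have e : ∑ a ∈ A, ∑ b ∈ A, c a b * ((1 + ε) * z a b - if a ∈ A ∧ b = σ a then ε else 0) =
          (1 + ε) * ∑ a ∈ A, ∑ b ∈ A, c a b * z a b - ε * ∑ a ∈ A, c a (σ a) := by
        rw [Finset.mul_sum, Finset.mul_sum, ← Finset.sum_sub_distrib]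
        refine Finset.sum_congr rfl fun a ha => ?_
        have e1 : ε * c a (σ a) = ∑ b ∈ A, if b = σ a then ε * c a b else 0 := by
          rw [Finset.sum_ite_eq' A (σ a), if_pos (hσ a ha).1]
        rw [e1, Finset.mul_sum, ← Finset.sum_sub_distrib]
        refine Finset.sum_congr rfl fun b _ => ?_
        simp only [ha, true_and]
        split_ifs <;> ring
      rw [e] at h
      refine ⟨σ, hσ, le_of_mul_le_mul_left (a := ε) ?_ hε⟩
      linarith
    · push Not at hA
      obtain ⟨S, hS, hSo, h1, h2, hcut⟩ := hA
      have hcard := Finset.card_sdiff_of_subset hS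
      obtain ⟨t, ht⟩ := Finset.card_pos.mp (show 0 < S.card by omega)
      obtain ⟨s, hs⟩ := Finset.card_pos.mp (show 0 < (A \ S).card by omega)
      have hs' : s ∉ S := (Finset.mem_sdiff.mp hs).2
      have ht' : t ∉ A \ S := fun h => (Finset.mem_sdiff.mp h).2 ht
      have hSSo : Odd (A \ S).card := by
        obtain ⟨k, hk⟩ := hSo
        obtain ⟨l, hl⟩ := hz.even_card
        exact ⟨l - k - 1, by omega⟩
      have hz1 := hz.contractTo hS hSo hcut hs'
      have hz2 := hz.contractTo Finset.sdiff_subset hSSo ((hz.cut_comm hS).trans hcut) ht'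
      have n1 := exists_near_matching hs' (fun c hc => ih _ (by
        rw [Finset.card_insert_of_notMem hs']; omega) _ rfl _ hz1 c hc)
      have n2 := exists_near_matching ht' (fun c hc => ih _ (by
        rw [Finset.card_insert_of_notMem ht']; omega) _ rfl _ hz2 c hc)
      rw [Finset.sdiff_sdiff_eq_self hS] at n2
      exact exists_matching_of_near_matchings hz hS n1 n2 c hc

end FractionalMatching

section Join

variable {V : Type*} [Fintype V] [DecidableEq V]

/-- The requirement one on the sets meeting `O` in an odd number of elements. -/
noncomputable def oddReq (O S : Finset V) : ℝ := if Odd (S ∩ O).card then 1 else 0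

theorem oddReq_compl {O : Finset V} (hO : Even O.card) (S : Finset V) :
    oddReq O Sᶜ = oddReq O S := by
  have h : (Sᶜ ∩ O).card + (S ∩ O).card = O.card := by
    rw [← Finset.card_union_of_disjoint, ← Finset.union_inter_distrib_right]
    · congr 1; ext; simp [or_comm, em]
    · exact Disjoint.mono Finset.inter_subset_left Finset.inter_subset_left disjoint_compl_left
  have : Odd (Sᶜ ∩ O).card ↔ Odd (S ∩ O).card := by
    rw [← h, Nat.even_add] at hO
    rw [← Nat.not_even_iff_odd, ← Nat.not_even_iff_odd, hO]
  simp only [oddReq, this]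

theorem oddReq_skew (O A B : Finset V) :
    oddReq O A + oddReq O B ≤ oddReq O (A ∩ B) + oddReq O (A ∪ B) ∨
      oddReq O A + oddReq O B ≤ oddReq O (A \ B) + oddReq O (B \ A) := by
  have h1 : ((A ∩ B) ∩ O).card + ((A ∪ B) ∩ O).card = (A ∩ O).card + (B ∩ O).card := by
    have := Finset.card_inter_add_card_union (A ∩ O) (B ∩ O)
    rwa [← Finset.inter_inter_distrib_right, ← Finset.union_inter_distrib_right] at this
  have h2 : ((A \ B) ∩ O).card + ((A ∩ B) ∩ O).card = (A ∩ O).card := by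
    rw [← Finset.card_union_of_disjoint, ← Finset.union_inter_distrib_right,
      Finset.sdiff_union_inter]
    exact Disjoint.mono Finset.inter_subset_left Finset.inter_subset_left
      (Finset.disjoint_sdiff_inter A B)
  have h3 : ((B \ A) ∩ O).card + ((A ∩ B) ∩ O).card = (B ∩ O).card := by
    rw [Finset.inter_comm A B, ← Finset.card_union_of_disjoint, ← Finset.union_inter_distrib_right,
      Finset.sdiff_union_inter]
    exact Disjoint.mono Finset.inter_subset_left Finset.inter_subset_left
      (Finset.disjoint_sdiff_inter B A)
  unfold oddReq
  simp only [Nat.odd_iff]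
  by_cases a1 : (A ∩ O).card % 2 = 1 <;> by_cases a2 : (B ∩ O).card % 2 = 1 <;>
    by_cases a3 : ((A ∩ B) ∩ O).card % 2 = 1 <;> by_cases a4 : ((A ∪ B) ∩ O).card % 2 = 1 <;>
    by_cases a5 : ((A \ B) ∩ O).card % 2 = 1 <;> by_cases a6 : ((B \ A) ∩ O).card % 2 = 1 <;>
    first
    | (exfalso; omega)
    | (simp only [a1, a2, a3, a4, a5, a6, if_true, if_false]; norm_num)

theorem oddReq_insert (O X : Finset V) (v : V) :
    oddReq O X - oddReq O {v} ≤ oddReq O (insert v X) := by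
  unfold oddReq
  by_cases hvO : v ∈ O
  · rw [Finset.singleton_inter_of_mem hvO]
    simp only [Finset.card_singleton, odd_one, if_true]
    split_ifs <;> norm_num
  · rw [Finset.singleton_inter_of_notMem hvO, Finset.insert_inter_of_notMem hvO]
    simp

/-- Under metric costs, a fractional join of `O` dominates a perfect matching of `O`. -/
theorem exists_matching_of_join {O : Finset V} (hO : Even O.card) {z : V → V → ℝ}
    (hs : ∀ a b, z a b = z b a) (h0 : ∀ a b, 0 ≤ z a b)
    (hcut : ∀ S : Finset V, Odd (S ∩ O).card → 1 ≤ cutVal z S)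
    {C : V → V → ℝ} (hC : ∀ a b, C a b = C b a) (hC0 : ∀ a, C a a = 0)
    (htri : ∀ u v w, C u w ≤ C u v + C v w) :
    ∃ σ, IsMatchingOn O σ ∧ ∑ a ∈ O, C a (σ a) ≤ ∑ a, ∑ b, C a b * z a b := by
  have step : ∀ L : Finset V, ∃ z' : V → V → ℝ, (∀ a b, z' a b = z' b a) ∧ (∀ a b, 0 ≤ z' a b) ∧
      (∀ S, oddReq O S ≤ cutVal z' S) ∧ (∀ v ∈ L, cutVal z' {v} = oddReq O {v}) ∧
      ∑ a, ∑ b, C a b * z' a b ≤ ∑ a, ∑ b, C a b * z a b := by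
    intro L
    induction L using Finset.induction_on with
    | empty =>
      refine ⟨z, hs, h0, fun S => ?_, by simp, le_rfl⟩
      unfold oddReq
      split_ifs with h
      · exact hcut S h
      · exact cutVal_nonneg h0 S
    | insert v L _ ih =>
      obtain ⟨z₁, g1, g2, g3, g4, g5⟩ := ih
      have hR : 0 ≤ oddReq O {v} := by unfold oddReq; split_ifs <;> norm_num
      obtain ⟨z₂, f1, f2, f3, f4, f5, f6⟩ := exists_complete_splitting g1 g2 (oddReq_compl hO)
        (oddReq_skew O) g3 hR (fun X _ => oddReq_insert O X v) hC hC0 Finset.univ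
        (fun a ha => absurd (Finset.mem_univ a) ha) (fun u _ w _ _ _ => htri u v w)
      refine ⟨z₂, f1, f2, f4, fun w hw => ?_, f6.trans g5⟩
      rcases Finset.mem_insert.mp hw with rfl | hwL
      · exact f5
      · exact le_antisymm ((f3 _).trans_eq (g4 w hwL)) (f4 _)
  obtain ⟨z', g1, g2, g3, g4, g5⟩ := step Finset.univ
  have hout : ∀ a, a ∉ O → ∀ b, a ≠ b → z' a b = 0 := fun a ha b hab => by
    refine le_antisymm ?_ (g2 a b)
    refine (le_cutVal g2 (Finset.mem_singleton_self a) (by simpa using hab.symm)).trans_eq ?_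
    rw [g4 a (Finset.mem_univ a)]
    simp [oddReq, ha]
  set w : V → V → ℝ := fun a b => if a = b then 0 else z' a b with hw
  have hsw : ∀ a b, w a b = w b a := fun a b => by simp only [hw, eq_comm (a := a), g1 a b]
  have hout' : ∀ a b, a ∉ O → w a b = 0 := fun a b ha => by
    by_cases hab : a = b
    · simp [hw, hab]
    · simp only [hw, if_neg hab]; exact hout a ha b hab
  have hcutw : ∀ X ⊆ O, ∑ a ∈ X, ∑ b ∈ O \ X, w a b = cutVal z' X := by
    intro X hX
    unfold cutVal
    refine Finset.sum_congr rfl fun a ha => ?_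
    have : O \ X ⊆ Xᶜ := fun b hb => by simpa using (Finset.mem_sdiff.mp hb).2
    rw [Finset.sum_subset this]
    · refine Finset.sum_congr rfl fun b hb => ?_
      have hab : a ≠ b := fun e => by subst e; simp [ha] at hb
      simp [hw, hab]
    · intro b hb hbO
      have hbX : b ∉ X := by simpa using hb
      rw [hsw]
      exact hout' b a fun h => hbO (Finset.mem_sdiff.mpr ⟨h, hbX⟩)
  have hfrac : IsFracMatching O w := by
    refine ⟨hsw, fun a b => ?_, fun a => by simp [hw], hout', fun a ha => ?_, fun X hX hXo => ?_⟩
    · simp only [hw]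
      split_ifs
      · exact le_rfl
      · exact g2 a b
    · have h1 := hcutw {a} (by simpa using ha)
      rw [Finset.sum_singleton, g4 a (Finset.mem_univ a), Finset.sdiff_singleton_eq_erase] at h1
      rw [← Finset.add_sum_erase O _ ha, h1]
      simp [hw, oddReq, ha]
    · rw [hcutw X hX]
      refine le_trans (le_of_eq ?_) (g3 X)
      rw [oddReq, Finset.inter_eq_left.mpr hX, if_pos hXo]
  obtain ⟨σ, hσ, hle⟩ := IsFracMatching.exists_matching _ O rfl w hfrac C hC
  refine ⟨σ, hσ, hle.trans (le_trans (le_of_eq ?_) g5)⟩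
  rw [Finset.sum_subset (Finset.subset_univ O)]
  · refine Finset.sum_congr rfl fun a _ => ?_
    rw [Finset.sum_subset (Finset.subset_univ O)]
    · refine Finset.sum_congr rfl fun b _ => ?_
      by_cases hab : a = b
      · simp [hab, hC0]
      · simp [hw, hab]
    · intro b _ hb
      rw [hsw, hout' b a hb, mul_zero]
  · intro a _ ha
    exact Finset.sum_eq_zero fun b _ => by rw [hout' a b ha, mul_zero]

end Join

section ClosedWalk

variable {V : Type*}

/-- The edges of the closed walk from `a` through a list of vertices to `r`. -/
def walkEdges (r : V) : V → List V → Multiset (Sym2 V)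
  | a, [] => {s(a, r)}
  | a, b :: t => s(a, b) ::ₘ walkEdges r b t

theorem exists_walkEdges_loop (r : V) {a x : V} {t : List V} (h : a ∈ x :: t) :
    ∃ t', walkEdges r x t' = s(a, a) ::ₘ walkEdges r x t ∧ t ⊆ t' := by
  induction t generalizing x with
  | nil =>
    rw [List.mem_singleton] at h
    subst h
    exact ⟨[a], rfl, by simp⟩
  | cons b u ih =>
    rcases List.mem_cons.mp h with rfl | h
    · exact ⟨a :: b :: u, rfl, by simp⟩
    · obtain ⟨t', h1, h2⟩ := ih h
      refine ⟨b :: t', ?_, List.cons_subset_cons b h2⟩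
      simp only [walkEdges]
      rw [h1, Multiset.cons_swap]

theorem exists_walkEdges_insert (r l : V) {a b x : V} {t : List V} (h : s(a, b) ∈ walkEdges r x t) :
    ∃ t', s(a, b) ::ₘ walkEdges r x t' = s(l, a) ::ₘ s(l, b) ::ₘ walkEdges r x t ∧
      t ⊆ t' ∧ l ∈ t' := by
  induction t generalizing x with
  | nil =>
    simp only [walkEdges, Multiset.mem_singleton] at h
    refine ⟨[l], ?_, by simp, by simp⟩
    simp only [walkEdges]
    rw [← h]
    rw [Sym2.eq_iff] at h
    rcases h with ⟨rfl, rfl⟩ | ⟨rfl, rfl⟩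
    · rw [Multiset.cons_swap, Sym2.eq_swap (a := a) (b := l)]
      exact congrArg _ (Multiset.cons_swap _ _ _)
    · rw [Multiset.cons_swap, Sym2.eq_swap (a := b) (b := l), Multiset.cons_swap s(l, a)]
      exact congrArg _ (Multiset.cons_swap _ _ _)
  | cons y u ih =>
    simp only [walkEdges, Multiset.mem_cons] at h
    by_cases hxy : s(a, b) = s(x, y)
    · refine ⟨l :: y :: u, ?_, by simp, by simp⟩
      simp only [walkEdges]
      rw [← hxy]
      rw [Sym2.eq_iff] at hxy
      rcases hxy with ⟨rfl, rfl⟩ | ⟨rfl, rfl⟩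
      · rw [Multiset.cons_swap, Sym2.eq_swap (a := a) (b := l)]
        exact congrArg _ (Multiset.cons_swap _ _ _)
      · rw [Multiset.cons_swap, Sym2.eq_swap (a := b) (b := l), Multiset.cons_swap s(l, a)]
        exact congrArg _ (Multiset.cons_swap _ _ _)
    · obtain ⟨t', h1, h2, h3⟩ := ih (h.resolve_left hxy)
      refine ⟨y :: t', ?_, List.cons_subset_cons y h2, List.mem_cons_of_mem _ h3⟩
      simp only [walkEdges]
      rw [Multiset.cons_swap, h1, Multiset.cons_swap s(x, y), Multiset.cons_swap s(x, y)]

variable [DecidableEq V]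

/-- The number of endpoints of an edge at `v`, so that loops count twice. -/
def Sym2.mult (v : V) : Sym2 V → ℕ :=
  Sym2.lift ⟨fun a b => (if a = v then 1 else 0) + (if b = v then 1 else 0),
    fun _ _ => add_comm _ _⟩

@[simp]
theorem Sym2.mult_mk (v a b : V) :
    Sym2.mult v s(a, b) = (if a = v then 1 else 0) + (if b = v then 1 else 0) := rfl

theorem Sym2.mult_eq_zero {v : V} {e : Sym2 V} : Sym2.mult v e = 0 ↔ v ∉ e := by
  induction e with
  | _ a b =>
    rw [Sym2.mult_mk, Sym2.mem_iff]
    rw [eq_comm (a := v), eq_comm (a := v)]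
    by_cases h1 : a = v <;> by_cases h2 : b = v <;> simp [h1, h2]

/-- The degree of `v` in a multigraph. -/
def multiDegree (E : Multiset (Sym2 V)) (v : V) : ℕ := (E.map (Sym2.mult v)).sum

theorem multiDegree_cons (e : Sym2 V) (E : Multiset (Sym2 V)) (v : V) :
    multiDegree (e ::ₘ E) v = Sym2.mult v e + multiDegree E v := by
  simp [multiDegree]

theorem exists_mem_of_multiDegree_ne_zero {E : Multiset (Sym2 V)} {v : V}
    (h : multiDegree E v ≠ 0) : ∃ e ∈ E, v ∈ e := by
  by_contra! hE
  refine h (Multiset.sum_eq_zero fun k hk => ?_)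
  obtain ⟨e, he, rfl⟩ := Multiset.mem_map.mp hk
  exact Sym2.mult_eq_zero.mpr (hE e he)

theorem notMem_of_multiDegree_eq_zero {E : Multiset (Sym2 V)} {v : V}
    (h : multiDegree E v = 0) : ∀ e ∈ E, v ∉ e := fun e he => by
  refine Sym2.mult_eq_zero.mp ((Multiset.sum_eq_zero_iff.mp h) _ (Multiset.mem_map_of_mem _ he))

/-- Euler's theorem: a multigraph with even degrees that contains a spanning tree of `W` is the edge
set of a closed walk through `W`. -/
theorem exists_eulerian_walk {r : V} (n : ℕ) : ∀ (E : Multiset (Sym2 V)), Multiset.card E = n →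
    ∀ (W : Finset V) (par : V → V) (rk : V → ℕ), IsRootedTree r W par rk →
      (∀ e ∈ E, ∀ v ∈ e, v ∈ W) → (∀ v ∈ W, v ≠ r → s(v, par v) ∈ E) →
      (∀ v, Even (multiDegree E v)) →
      ∃ t, walkEdges r r t = s(r, r) ::ₘ E ∧ ∀ v ∈ W, v ∈ r :: t := by
  induction n with
  | zero =>
    intro E hE W par rk hT _ htree _
    rw [Multiset.card_eq_zero] at hE
    subst hE
    refine ⟨[], rfl, fun v hv => ?_⟩
    by_contra hvr
    simpa using htree v hv (by simpa using hvr)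
  | succ n ih =>
    intro E hE W par rk hT hW htree hev
    by_cases hloop : ∃ a, s(a, a) ∈ E
    · obtain ⟨a, ha⟩ := hloop
      obtain ⟨E', rfl⟩ := Multiset.exists_cons_of_mem ha
      obtain ⟨t, h1, h2⟩ := ih E' (by simpa using hE) W par rk hT
        (fun e he => hW e (Multiset.mem_cons_of_mem he))
        (fun v hv hvr => by
          refine (Multiset.mem_cons.mp (htree v hv hvr)).resolve_left fun e => ?_
          rw [Sym2.eq_iff] at e
          exact hT.par_ne hv hvr (by rcases e with ⟨e1, e2⟩ | ⟨e1, e2⟩ <;> exact e2.trans e1.symm))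
        (fun v => by
          have := hev v
          rw [multiDegree_cons, Nat.even_add] at this
          refine this.mp ?_
          rw [Sym2.mult_mk]
          split_ifs <;> decide)
      obtain ⟨t', h3, h4⟩ := exists_walkEdges_loop r (h2 a (hW _ ha a (Sym2.mem_mk_left a a)))
      refine ⟨t', ?_, fun v hv => List.cons_subset_cons r h4 (h2 v hv)⟩
      rw [h3, h1, Multiset.cons_swap]
    · push Not at hloop
      have step : ∀ (l a b : V) (E₂ : Multiset (Sym2 V)), E = s(l, a) ::ₘ s(l, b) ::ₘ E₂ →
          ∀ (W' : Finset V), IsRootedTree r W' par rk →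
          (∀ e ∈ s(a, b) ::ₘ E₂, ∀ v ∈ e, v ∈ W') →
          (∀ v ∈ W', v ≠ r → s(v, par v) ∈ s(a, b) ::ₘ E₂) → (∀ v ∈ W, v ∈ W' ∨ v = l) →
          ∃ t, walkEdges r r t = s(r, r) ::ₘ E ∧ ∀ v ∈ W, v ∈ r :: t := by
        intro l a b E₂ hEE W' hT' hW' htree' hWW'
        obtain ⟨t, h1, h2⟩ := ih (s(a, b) ::ₘ E₂) (by
            rw [hEE] at hE; simpa using hE) W' par rk hT' hW' htree' (fun v => by
          have := hev v
          rw [hEE] at this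
          simp only [multiDegree_cons, Sym2.mult_mk] at this ⊢
          rw [Nat.even_iff] at this ⊢
          split_ifs at this ⊢ <;> omega)
        obtain ⟨t', h3, h4, h5⟩ := exists_walkEdges_insert r l (a := a) (b := b) (x := r) (t := t)
          (by rw [h1]; simp)
        refine ⟨t', ?_, fun v hv => ?_⟩
        · rw [h1, Multiset.cons_swap s(r, r), Multiset.cons_swap s(l, b),
            Multiset.cons_swap s(l, a), Multiset.cons_inj_right] at h3
          rw [h3, hEE, Multiset.cons_swap s(l, b), Multiset.cons_swap s(l, a)]
        · rcases hWW' v hv with h | rfl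
          · exact List.cons_subset_cons r h4 (h2 v h)
          · exact List.mem_cons_of_mem _ h5
      have hne : (W.erase r).Nonempty := by
        by_contra hemp
        rw [Finset.not_nonempty_iff_eq_empty] at hemp
        have hWr : ∀ v ∈ W, v = r := fun v hv => by
          by_contra hvr
          have : v ∈ W.erase r := Finset.mem_erase.mpr ⟨hvr, hv⟩
          rw [hemp] at this
          simp at this
        obtain ⟨e, he⟩ := Multiset.card_pos_iff_exists_mem.mp (show 0 < Multiset.card E by omega)
        induction e with
        | _ a b =>
          have h1 := hWr a (hW _ he a (Sym2.mem_mk_left a b))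
          have h2 := hWr b (hW _ he b (Sym2.mem_mk_right a b))
          rw [h1, h2] at he
          exact hloop r he
      obtain ⟨l, hl, hmax⟩ := Finset.exists_max_image (W.erase r) rk hne
      obtain ⟨hlr, hlW⟩ := Finset.mem_erase.mp hl
      have hparl : ∀ v ∈ W, v ≠ r → par v ≠ l := fun v hv hvr e => by
        have h1 := hT.rk_lt v hv hvr
        have h2 := hmax v (Finset.mem_erase.mpr ⟨hvr, hv⟩)
        rw [e] at h1
        omega
      obtain ⟨E₁, hE₁⟩ := Multiset.exists_cons_of_mem (htree l hlW hlr)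
      have hpl := hT.par_ne hlW hlr
      have hpW := hT.par_mem l hlW hlr
      have hodd : ¬ Even (multiDegree E₁ l) := by
        have := hev l
        rw [hE₁, multiDegree_cons, Sym2.mult_mk, if_pos rfl, if_neg hpl, Nat.even_add] at this
        intro h
        exact absurd (this.mpr h) (by decide)
      obtain ⟨e₂, he₂, hle₂⟩ := exists_mem_of_multiDegree_ne_zero (E := E₁) (v := l)
        (fun h => hodd (by rw [h]; decide))
      obtain ⟨q, rfl⟩ := Sym2.mem_iff_exists.mp hle₂
      obtain ⟨E₂, rfl⟩ := Multiset.exists_cons_of_mem he₂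
      have hql : q ≠ l := fun e => hloop l (by
        rw [hE₁, e]; simp)
      have hqW : q ∈ W := hW s(l, q) (by rw [hE₁]; simp) q (Sym2.mem_mk_right l q)
      have hnot : ∀ v ∈ W, v ≠ r → v ≠ l → ∀ x, s(v, par v) ≠ s(l, x) := fun v hv hvr hvl x e => by
        rw [Sym2.eq_iff] at e
        rcases e with ⟨e1, _⟩ | ⟨_, e2⟩
        · exact hvl e1
        · exact hparl v hv hvr e2
      by_cases hdeg : multiDegree E₂ l = 0
      · have hE2 := notMem_of_multiDegree_eq_zero hdeg
        refine step l (par l) q E₂ hE₁ (W.erase l) ⟨?_, fun v hv hvr => ?_, fun v hv hvr => ?_⟩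
          (fun e he v hv => ?_) (fun v hv hvr => ?_) (fun v hv => ?_)
        · exact Finset.mem_erase.mpr ⟨hlr.symm, hT.root_mem⟩
        · have hvW := Finset.mem_of_mem_erase hv
          exact Finset.mem_erase.mpr ⟨hparl v hvW hvr, hT.par_mem v hvW hvr⟩
        · exact hT.rk_lt v (Finset.mem_of_mem_erase hv) hvr
        · rcases Multiset.mem_cons.mp he with rfl | he
          · rcases Sym2.mem_iff.mp hv with rfl | rfl
            · exact Finset.mem_erase.mpr ⟨hpl, hpW⟩
            · exact Finset.mem_erase.mpr ⟨hql, hqW⟩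
          · refine Finset.mem_erase.mpr ⟨fun h => hE2 e he (h ▸ hv), hW e ?_ v hv⟩
            rw [hE₁]
            exact Multiset.mem_cons_of_mem (Multiset.mem_cons_of_mem he)
        · obtain ⟨hvl, hvW⟩ := Finset.mem_erase.mp hv
          have h1 := htree v hvW hvr
          rw [hE₁] at h1
          exact Multiset.mem_cons_of_mem ((Multiset.mem_cons.mp ((Multiset.mem_cons.mp
            h1).resolve_left (hnot v hvW hvr hvl _))).resolve_left (hnot v hvW hvr hvl _))
        · by_cases hvl : v = l
          · exact Or.inr hvl
          · exact Or.inl (Finset.mem_erase.mpr ⟨hvl, hv⟩)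
      · obtain ⟨e₃, he₃, hle₃⟩ := exists_mem_of_multiDegree_ne_zero hdeg
        obtain ⟨a, rfl⟩ := Sym2.mem_iff_exists.mp hle₃
        obtain ⟨E₃, rfl⟩ := Multiset.exists_cons_of_mem he₃
        have haW : a ∈ W := hW s(l, a) (by rw [hE₁]; simp) a (Sym2.mem_mk_right l a)
        have hEE : E = s(l, q) ::ₘ s(l, a) ::ₘ s(l, par l) ::ₘ E₃ := by
          rw [hE₁, Multiset.cons_swap, Multiset.cons_swap s(l, par l)]
        refine step l q a (s(l, par l) ::ₘ E₃) hEE W hT (fun e he v hv => ?_) (fun v hv hvr => ?_)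
          (fun v hv => Or.inl hv)
        · rcases Multiset.mem_cons.mp he with rfl | he
          · rcases Sym2.mem_iff.mp hv with rfl | rfl
            · exact hqW
            · exact haW
          · refine hW e ?_ v hv
            rw [hEE]
            exact Multiset.mem_cons_of_mem (Multiset.mem_cons_of_mem he)
        · by_cases hvl : v = l
          · rw [hvl]; simp
          · have h1 := htree v hv hvr
            rw [hEE] at h1
            exact Multiset.mem_cons_of_mem ((Multiset.mem_cons.mp ((Multiset.mem_cons.mp
              h1).resolve_left (hnot v hv hvr hvl _))).resolve_left (hnot v hv hvr hvl _))

end ClosedWalk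

section ShortcutTour

variable {V : Type*}

/-- The total cost of a multiset of edges. -/
def multiCost (C : V → V → ℝ) (hC : ∀ a b, C a b = C b a) (E : Multiset (Sym2 V)) : ℝ :=
  (E.map (Sym2.lift ⟨C, hC⟩)).sum

theorem multiCost_cons (C : V → V → ℝ) (hC : ∀ a b, C a b = C b a) (a b : V)
    (E : Multiset (Sym2 V)) : multiCost C hC (s(a, b) ::ₘ E) = C a b + multiCost C hC E := by
  simp [multiCost]

theorem multiCost_walkEdges_le (C : V → V → ℝ) (hC : ∀ a b, C a b = C b a)
    (htri : ∀ u v w, C u w ≤ C u v + C v w) (r : V) {t' t : List V} (h : t'.Sublist t) :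
    ∀ a, multiCost C hC (walkEdges r a t') ≤ multiCost C hC (walkEdges r a t) := by
  induction h with
  | slnil => exact fun a => le_rfl
  | @cons t' t b _ ih =>
    intro a
    rw [walkEdges, multiCost_cons]
    refine le_trans ?_ (add_le_add_right (ih b) _)
    cases t' with
    | nil => simpa [walkEdges, multiCost] using htri a b r
    | cons d u =>
      rw [walkEdges, walkEdges, multiCost_cons, multiCost_cons]
      linarith [htri a b d]
  | cons_cons b _ ih =>
    intro a
    rw [walkEdges, walkEdges, multiCost_cons, multiCost_cons]
    exact add_le_add_right (ih b) _

variable [DecidableEq V]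

theorem sum_zip_eq_multiCost (c : Finset V → ℝ) (C : V → V → ℝ) (hC : ∀ a b, C a b = C b a)
    (hCc : ∀ a b, a ≠ b → C a b = c {a, b}) (r : V) (t : List V) :
    ∀ a, (a :: t).Nodup → r ∉ t → (t = [] → a ≠ r) →
      (((a :: t).zip (t ++ [r])).map (fun p => c {p.1, p.2})).sum
        = multiCost C hC (walkEdges r a t) := by
  induction t with
  | nil =>
    intro a _ _ h
    simp [walkEdges, multiCost, hCc a r (h rfl)]
  | cons b t ih =>
    intro a hnd hr _
    have hab : a ≠ b := fun e => by simp [e] at hnd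
    have hbr : b ≠ r := fun e => hr (by simp [e])
    rw [walkEdges, multiCost_cons, ← ih b (List.nodup_cons.mp hnd).2
      (fun h => hr (List.mem_cons_of_mem _ h)) (fun _ => hbr), hCc a b hab]
    simp

/-- Shortcutting a connected Eulerian multigraph yields a tour that is no more expensive. -/
theorem exists_tour_of_multigraph (c : Finset V → ℝ) {C : V → V → ℝ} (hC : ∀ a b, C a b = C b a)
    (hCc : ∀ a b, a ≠ b → C a b = c {a, b}) (hC0 : ∀ a, C a a = 0)
    (htri : ∀ u v w, C u w ≤ C u v + C v w) {r : V} {E : Multiset (Sym2 V)}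
    {W : Finset V} {par : V → V} {rk : V → ℕ} (hT : IsRootedTree r W par rk)
    (hW : ∀ e ∈ E, ∀ v ∈ e, v ∈ W) (htree : ∀ v ∈ W, v ≠ r → s(v, par v) ∈ E)
    (hev : ∀ v, Even (multiDegree E v)) :
    ∃ t : List V, t.Nodup ∧ t.head? = some r ∧ W ⊆ t.toFinset ∧
      tourCost c t ≤ multiCost C hC E := by
  obtain ⟨t, ht, hWt⟩ := exists_eulerian_walk _ E rfl W par rk hT hW htree hev
  set t' := (t.filter (fun v => v ≠ r)).dedup with ht'
  have hsub : t'.Sublist t := (List.dedup_sublist _).trans List.filter_sublist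
  have hr : r ∉ t' := by simp [ht']
  have hnd : (r :: t').Nodup := List.nodup_cons.mpr ⟨hr, List.nodup_dedup _⟩
  have hle := multiCost_walkEdges_le C hC htri r hsub r
  rw [ht, multiCost_cons, hC0, zero_add] at hle
  refine ⟨r :: t', hnd, rfl, fun v hv => ?_, le_trans ?_ hle⟩
  · have := hWt v hv
    rw [List.mem_toFinset, List.mem_cons]
    by_cases hvr : v = r
    · exact Or.inl hvr
    · refine Or.inr ?_
      simp only [ht', List.mem_dedup, List.mem_filter]
      exact ⟨(List.mem_cons.mp this).resolve_left hvr, by simpa using hvr⟩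
  · by_cases hnil : t' = []
    · rw [hnil]
      simp [tourCost, walkEdges, multiCost, hC0]
    · rw [← sum_zip_eq_multiCost c C hC hCc r t' r hnd hr (fun h => absurd h hnil)]
      have hlen : ¬ (r :: t').length ≤ 1 := by
        have := List.length_pos_iff.mpr hnil
        simp only [List.length_cons]
        omega
      rw [tourCost, if_neg hlen]
      simp

end ShortcutTour

section TreeJoin

variable {V : Type*} [DecidableEq V]

/-- The edges of a rooted tree, as a multigraph. -/
def treeEdges (r : V) (W : Finset V) (par : V → V) : Multiset (Sym2 V) :=
  (W.erase r).val.map fun v => s(v, par v)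

theorem multiDegree_add (E F : Multiset (Sym2 V)) (v : V) :
    multiDegree (E + F) v = multiDegree E v + multiDegree F v := by
  simp [multiDegree]

theorem multiDegree_treeEdges (r : V) (W : Finset V) (par : V → V) (a : V) :
    multiDegree (treeEdges r W par) a = ∑ v ∈ W.erase r, Sym2.mult a s(v, par v) := by
  simp only [multiDegree, treeEdges, Multiset.map_map]
  rfl

theorem odd_card_filter_odd_multiDegree (r : V) (W : Finset V) (par : V → V) (S : Finset V) :
    Odd (S.filter fun a => Odd (multiDegree (treeEdges r W par) a)).card ↔
      Odd ((W.erase r).filter fun v => ¬(v ∈ S ↔ par v ∈ S)).card := by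
  rw [← Finset.odd_sum_iff_odd_card_odd]
  simp only [multiDegree_treeEdges]
  rw [Finset.sum_comm, Finset.odd_sum_iff_odd_card_odd]
  have : ∀ v, Odd (∑ a ∈ S, Sym2.mult a s(v, par v)) ↔ ¬(v ∈ S ↔ par v ∈ S) := fun v => by
    simp only [Sym2.mult_mk, Finset.sum_add_distrib, Finset.sum_ite_eq]
    by_cases h1 : v ∈ S <;> by_cases h2 : par v ∈ S <;> simp [h1, h2]
  simp only [this]

/-- The edges of a perfect matching. -/
def matchingEdges (O : Finset V) (σ : V → V) : Finset (Sym2 V) := O.image fun a => s(a, σ a)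

theorem IsMatchingOn.mult_sum {O : Finset V} {σ : V → V} (h : IsMatchingOn O σ) (v : V) :
    multiDegree (matchingEdges O σ).val v = if v ∈ O then 1 else 0 := by
  change ∑ e ∈ matchingEdges O σ, Sym2.mult v e = _
  have key : ∀ e ∈ matchingEdges O σ, v ∈ e → v ∈ O ∧ e = s(v, σ v) := fun e he hve => by
    obtain ⟨a, ha, rfl⟩ := Finset.mem_image.mp he
    rcases Sym2.mem_iff.mp hve with rfl | rfl
    · exact ⟨ha, rfl⟩
    · exact ⟨(h a ha).1, by rw [(h a ha).2.2, Sym2.eq_swap]⟩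
  split_ifs with hv
  · rw [Finset.sum_eq_single s(v, σ v)]
    · rw [Sym2.mult_mk, if_pos rfl, if_neg (h v hv).2.1]
    · exact fun e he hne => Sym2.mult_eq_zero.mpr fun hve => hne (key e he hve).2
    · exact fun hn => absurd (Finset.mem_image_of_mem _ hv) hn
  · exact Finset.sum_eq_zero fun e he => Sym2.mult_eq_zero.mpr fun hve => hv (key e he hve).1

theorem IsMatchingOn.two_mul_multiCost {O : Finset V} {σ : V → V} (h : IsMatchingOn O σ)
    (C : V → V → ℝ) (hC : ∀ a b, C a b = C b a) :
    2 * multiCost C hC (matchingEdges O σ).val = ∑ a ∈ O, C a (σ a) := by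
  change 2 * ∑ e ∈ matchingEdges O σ, Sym2.lift ⟨C, hC⟩ e = _
  have := Finset.sum_comp (s := O) (Sym2.lift ⟨C, hC⟩) (fun a => s(a, σ a))
  simp only [Sym2.lift_mk] at this
  rw [this, Finset.mul_sum]
  refine Finset.sum_congr rfl fun e he => ?_
  obtain ⟨a, ha, rfl⟩ := Finset.mem_image.mp he
  have hf : O.filter (fun b => s(b, σ b) = s(a, σ a)) = {a, σ a} := by
    ext b
    simp only [Finset.mem_filter, Finset.mem_insert, Finset.mem_singleton, Sym2.eq_iff]
    constructor
    · rintro ⟨_, h1 | h1⟩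
      · exact Or.inl h1.1
      · exact Or.inr h1.1
    · rintro (rfl | rfl)
      · exact ⟨ha, Or.inl ⟨rfl, rfl⟩⟩
      · exact ⟨(h a ha).1, Or.inr ⟨rfl, (h a ha).2.2⟩⟩
  rw [hf, Finset.card_pair (h a ha).2.1.symm]
  simp

/-- A tree whose odd-degree vertices are joined by a fractional join extends to a tour. -/
theorem exists_tour_of_tree_of_join [Fintype V] (c : Finset V → ℝ) {C : V → V → ℝ}
    (hC : ∀ a b, C a b = C b a) (hCc : ∀ a b, a ≠ b → C a b = c {a, b}) (hC0 : ∀ a, C a a = 0)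
    (htri : ∀ u v w, C u w ≤ C u v + C v w) {r : V}
    {W : Finset V} {par : V → V} {rk : V → ℕ} (hT : IsRootedTree r W par rk)
    {z : V → V → ℝ} (hs : ∀ a b, z a b = z b a) (h0 : ∀ a b, 0 ≤ z a b)
    (hcut : ∀ S : Finset V, Odd ((W.erase r).filter fun v => ¬(v ∈ S ↔ par v ∈ S)).card →
      1 ≤ cutVal z S) :
    ∃ t : List V, t.Nodup ∧ t.head? = some r ∧ W ⊆ t.toFinset ∧
      tourCost c t ≤ ∑ v ∈ W.erase r, C v (par v) + (1 / 2) * ∑ a, ∑ b, C a b * z a b := by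
  set O : Finset V := Finset.univ.filter fun a => Odd (multiDegree (treeEdges r W par) a) with hOdef
  have hSO : ∀ S : Finset V, S ∩ O = S.filter fun a => Odd (multiDegree (treeEdges r W par) a) :=
    fun S => by ext; simp [hOdef]
  have hO : Even O.card := by
    rw [← Nat.not_odd_iff_even, hOdef, odd_card_filter_odd_multiDegree]
    simp
  obtain ⟨σ, hσ, hle⟩ := exists_matching_of_join hO hs h0
    (fun S hS => hcut S (by rwa [hSO, odd_card_filter_odd_multiDegree] at hS)) hC hC0 htri
  have hTW : ∀ e ∈ treeEdges r W par, ∀ v ∈ e, v ∈ W := fun e he v hv => by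
    obtain ⟨a, ha, rfl⟩ := Multiset.mem_map.mp he
    obtain ⟨har, haW⟩ := Finset.mem_erase.mp ha
    rcases Sym2.mem_iff.mp hv with rfl | rfl
    · exact haW
    · exact hT.par_mem a haW har
  have hOW : O ⊆ W := fun v hv => by
    have hodd := (Finset.mem_filter.mp hv).2
    obtain ⟨e, he, hve⟩ := exists_mem_of_multiDegree_ne_zero
      (E := treeEdges r W par) (v := v) (fun h => by rw [h] at hodd; exact absurd hodd (by decide))
    exact hTW e he v hve
  obtain ⟨t, h1, h2, h3, h4⟩ := exists_tour_of_multigraph c hC hCc hC0 htri hT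
    (E := treeEdges r W par + (matchingEdges O σ).val)
    (fun e he v hv => by
      rcases Multiset.mem_add.mp he with he | he
      · exact hTW e he v hv
      · obtain ⟨a, ha, rfl⟩ := Finset.mem_image.mp (Finset.mem_val.mp he)
        rcases Sym2.mem_iff.mp hv with rfl | rfl
        · exact hOW ha
        · exact hOW (hσ a ha).1)
    (fun v hv hvr => Multiset.mem_add.mpr (Or.inl
      (Multiset.mem_map.mpr ⟨v, Finset.mem_erase.mpr ⟨hvr, hv⟩, rfl⟩)))
    (fun v => by
      rw [multiDegree_add, hσ.mult_sum]
      split_ifs with h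
      · exact (Finset.mem_filter.mp h).2.add_one
      · rw [add_zero, ← Nat.not_odd_iff_even]
        exact fun hodd => h (Finset.mem_filter.mpr ⟨Finset.mem_univ v, hodd⟩))
  refine ⟨t, h1, h2, h3, h4.trans ?_⟩
  have hsum : multiCost C hC (treeEdges r W par + (matchingEdges O σ).val)
      = ∑ v ∈ W.erase r, C v (par v) + multiCost C hC (matchingEdges O σ).val := by
    simp only [multiCost, treeEdges, Multiset.map_add, Multiset.sum_add, Multiset.map_map]
    rfl
  have := hσ.two_mul_multiCost C hC
  rw [hsum]
  linarith

end TreeJoin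

section ParityCorrection

variable {V : Type*} [DecidableEq V]

/-- `η v` is the largest value of `y` in the subtree below `v`. -/
theorem IsRootedTree.exists_subtreeMax {r : V} {W : Finset V} {par : V → V} {rk : V → ℕ}
    (hT : IsRootedTree r W par rk) (y : V → ℝ) :
    ∃ η : V → ℝ, (∀ v ∈ W, y v ≤ η v) ∧ (∀ v ∈ W, v ≠ r → η v ≤ η (par v)) ∧
      (∀ v, ∃ d, y d = η v) ∧
      ∀ v ∈ W, ∀ S : Finset V, v ∈ S → ∃ d, y d = η v ∧
        (d ∈ S ∨ ∃ u ∈ W, u ≠ r ∧ η u = η v ∧ u ∉ S ∧ par u ∈ S) := by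
  classical
  set R : V → V → Prop := Relation.ReflTransGen fun a b => a ∈ W ∧ a ≠ r ∧ b = par a with hR
  have hex : ∀ v, ∃ d, v ∈ W → d ∈ W ∧ R d v ∧ ∀ d' ∈ W, R d' v → y d' ≤ y d := fun v => by
    by_cases hv : v ∈ W
    · obtain ⟨d, hd, hmax⟩ := Finset.exists_max_image (W.filter fun d => R d v) y
        ⟨v, Finset.mem_filter.mpr ⟨hv, Relation.ReflTransGen.refl⟩⟩
      obtain ⟨h1, h2⟩ := Finset.mem_filter.mp hd
      exact ⟨d, fun _ => ⟨h1, h2, fun d' h3 h4 => hmax d' (Finset.mem_filter.mpr ⟨h3, h4⟩)⟩⟩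
    · exact ⟨v, fun h => absurd h hv⟩
  choose D hD using hex
  refine ⟨fun v => y (D v), fun v hv => (hD v hv).2.2 v hv Relation.ReflTransGen.refl,
    fun v hv hvr => ?_, fun v => ⟨D v, rfl⟩, fun v hv S hvS => ⟨D v, rfl, ?_⟩⟩
  · exact (hD _ (hT.par_mem v hv hvr)).2.2 _ (hD v hv).1 ((hD v hv).2.1.tail ⟨hv, hvr, rfl⟩)
  · by_contra! hcon
    obtain ⟨hdS, hno⟩ := hcon
    have key : ∀ d, R d v → d ∉ S → ∃ u ∈ W, u ≠ r ∧ R d u ∧ R u v ∧ u ∉ S ∧ par u ∈ S := by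
      intro d hd
      induction hd using Relation.ReflTransGen.head_induction_on with
      | refl => exact fun h => absurd hvS h
      | @head a b hab hbv ih =>
        intro haS
        obtain ⟨haW, har, rfl⟩ := hab
        by_cases hb : par a ∈ S
        · exact ⟨a, haW, har, Relation.ReflTransGen.refl, hbv.head ⟨haW, har, rfl⟩, haS, hb⟩
        · obtain ⟨u, h1, h2, h3, h4, h5, h6⟩ := ih hb
          exact ⟨u, h1, h2, h3.head ⟨haW, har, rfl⟩, h4, h5, h6⟩
    obtain ⟨u, h1, h2, h3, h4, h5, h6⟩ := key _ (hD v hv).2.1 hdS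
    refine hno u h1 h2 (le_antisymm ?_ ?_) h5 h6
    · exact (hD v hv).2.2 _ (hD u h1).1 ((hD u h1).2.1.trans h4)
    · exact (hD u h1).2.2 _ (hD v hv).1 h3

theorem IsRootedTree.exists_crossing {r : V} {W : Finset V} {par : V → V} {rk : V → ℕ}
    (hT : IsRootedTree r W par rk) {S : Finset V} (hr : r ∉ S) (n : ℕ) :
    ∀ m ∈ W, m ∈ S → rk m = n → ∃ v ∈ W, v ≠ r ∧ v ∈ S ∧ par v ∉ S ∧ rk v ≤ n := by
  induction n using Nat.strong_induction_on with
  | _ n ih =>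
    intro m hm hmS hn
    have hmr : m ≠ r := fun e => hr (e ▸ hmS)
    by_cases hp : par m ∈ S
    · have hlt := hT.rk_lt m hm hmr
      rw [hn] at hlt
      obtain ⟨v, h1, h2, h3, h4, h5⟩ := ih _ hlt _ (hT.par_mem m hm hmr) hp rfl
      exact ⟨v, h1, h2, h3, h4, h5.trans hlt.le⟩
    · exact ⟨m, hm, hmr, hmS, hp, hn.le⟩

/-- The edge from `u` to `w` as a symmetric weight function. -/
def edgeWeight (u w a b : V) : ℝ :=
  (if a = u ∧ b = w then 1 else 0) + (if a = w ∧ b = u then 1 else 0)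

theorem edgeWeight_symm (u w a b : V) : edgeWeight u w a b = edgeWeight u w b a := by
  unfold edgeWeight
  simp only [and_comm (a := a = _)]
  exact add_comm _ _

theorem edgeWeight_nonneg (u w a b : V) : 0 ≤ edgeWeight u w a b := by
  unfold edgeWeight
  split_ifs <;> norm_num

variable [Fintype V]

theorem sum_mul_edgeWeight (C : V → V → ℝ) (u w : V) :
    ∑ a, ∑ b, C a b * edgeWeight u w a b = C u w + C w u := by
  simp only [edgeWeight, mul_add, Finset.sum_add_distrib, ite_and, mul_ite, mul_one, mul_zero]
  simp

theorem one_le_cutVal_edgeWeight {u w : V} {S : Finset V} (h : ¬(u ∈ S ↔ w ∈ S)) :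
    1 ≤ cutVal (edgeWeight u w) S := by
  by_cases hu : u ∈ S
  · have hw : w ∉ S := fun hw => h ⟨fun _ => hw, fun _ => hu⟩
    refine le_trans ?_ (le_cutVal (edgeWeight_nonneg u w) hu hw)
    unfold edgeWeight
    rw [if_pos ⟨rfl, rfl⟩]
    split_ifs <;> norm_num
  · have hw : w ∈ S := by tauto
    refine le_trans ?_ (le_cutVal (edgeWeight_nonneg u w) hw hu)
    unfold edgeWeight
    rw [if_pos (c := w = w ∧ u = u) ⟨rfl, rfl⟩]
    split_ifs <;> norm_num

theorem cutVal_mul_add_sum {ι : Type*} (α : ℝ) (x : V → V → ℝ) (s : Finset ι) (β : ι → ℝ)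
    (χ : ι → V → V → ℝ) (S : Finset V) :
    cutVal (fun a b => α * x a b + ∑ i ∈ s, β i * χ i a b) S
      = α * cutVal x S + ∑ i ∈ s, β i * cutVal (χ i) S := by
  unfold cutVal
  simp only [Finset.sum_add_distrib, Finset.mul_sum]
  congr 1
  simp only [Finset.sum_comm (t := s)]

/-- Correcting the parity of a tree by a combination of the LP solution and the tree itself. -/
theorem exists_tour_of_tree (c : Finset V → ℝ) {C : V → V → ℝ}
    (hC : ∀ a b, C a b = C b a) (hCc : ∀ a b, a ≠ b → C a b = c {a, b}) (hC0 : ∀ a, C a a = 0)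
    (htri : ∀ u v w, C u w ≤ C u v + C v w) {r : V} {y η : V → ℝ} {x : V → V → ℝ}
    (hx : CutFeasible r Finset.univ y x)
    {W : Finset V} {par : V → V} {rk : V → ℕ} (hT : IsRootedTree r W par rk)
    {α γ : ℝ} (hα : 0 ≤ α) (hα2 : 2 * α ≤ 1) (hαγ : 1 ≤ 3 * (1 - 2 * α) + α * (2 * γ))
    (hγ : ∀ v ∈ W, γ ≤ y v) (hη1 : ∀ v, η v ≤ 1)
    (hη : ∀ v ∈ W, v ≠ r → ∀ S : Finset V, v ∈ S → ∃ d, y d = η v ∧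
        (d ∈ S ∨ ∃ u ∈ W, u ≠ r ∧ η u = η v ∧ u ∉ S ∧ par u ∈ S)) :
    ∃ t : List V, t.Nodup ∧ t.head? = some r ∧ W ⊆ t.toFinset ∧
      tourCost c t ≤ ∑ v ∈ W.erase r, C v (par v) * (2 - 2 * α * η v) +
        α * ((1 / 2) * ∑ a, ∑ b, C a b * x a b) := by
  have hβ : ∀ v, 1 - 2 * α ≤ 1 - 2 * α * η v := fun v => by nlinarith [hη1 v]
  have hβ0 : ∀ v, 0 ≤ 1 - 2 * α * η v := fun v => by linarith [hβ v]
  set z : V → V → ℝ := fun a b =>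
    α * x a b + ∑ v ∈ W.erase r, (1 - 2 * α * η v) * edgeWeight v (par v) a b with hz
  have hzs : ∀ a b, z a b = z b a := fun a b => by
    simp only [hz, hx.symm a b, edgeWeight_symm _ _ a b]
  have hz0 : ∀ a b, 0 ≤ z a b := fun a b =>
    add_nonneg (mul_nonneg hα (hx.nonneg a b)) (Finset.sum_nonneg fun v _ =>
      mul_nonneg (hβ0 v) (edgeWeight_nonneg _ _ _ _))
  have hcut0 : ∀ S : Finset V, r ∉ S →
      Odd ((W.erase r).filter fun v => ¬(v ∈ S ↔ par v ∈ S)).card → 1 ≤ cutVal z S := by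
    intro S hrS hodd
    set X := (W.erase r).filter fun v => ¬(v ∈ S ↔ par v ∈ S) with hX
    have hmemX : ∀ v, v ∈ X ↔ (v ≠ r ∧ v ∈ W) ∧ ¬(v ∈ S ↔ par v ∈ S) := fun v => by
      rw [hX, Finset.mem_filter, Finset.mem_erase]
    have hzS : α * cutVal x S + ∑ v ∈ X, (1 - 2 * α * η v) ≤ cutVal z S := by
      rw [hz, cutVal_mul_add_sum]
      refine add_le_add_right ?_ _
      refine le_trans (Finset.sum_le_sum (g := fun v =>
        (1 - 2 * α * η v) * cutVal (edgeWeight v (par v)) S) fun v hv => ?_)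
        (Finset.sum_le_sum_of_subset_of_nonneg (Finset.filter_subset _ _) fun v _ _ =>
          mul_nonneg (hβ0 v) (cutVal_nonneg (edgeWeight_nonneg _ _) S))
      exact le_mul_of_one_le_right (hβ0 v)
        (one_le_cutVal_edgeWeight (Finset.mem_filter.mp hv).2)
    refine le_trans ?_ hzS
    by_cases hcard : X.card = 1
    · obtain ⟨v, hv⟩ := Finset.card_eq_one.mp hcard
      rw [hv, Finset.sum_singleton]
      have hvX : v ∈ X := by rw [hv]; exact Finset.mem_singleton_self v
      have huniq : ∀ u ∈ X, u = v := fun u hu => by rwa [hv, Finset.mem_singleton] at hu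
      obtain ⟨⟨hvr, hvW⟩, hcr⟩ := (hmemX v).mp hvX
      have hpS : par v ∉ S := fun hp => by
        obtain ⟨w, h1, h2, h3, h4, h5⟩ := hT.exists_crossing hrS _ _ (hT.par_mem v hvW hvr) hp rfl
        have := huniq w ((hmemX w).mpr ⟨⟨h2, h1⟩, by tauto⟩)
        rw [this] at h5
        exact absurd (hT.rk_lt v hvW hvr) (not_lt.mpr h5)
      have hvS : v ∈ S := by tauto
      obtain ⟨d, hd, hd'⟩ := hη v hvW hvr S hvS
      have hdS : d ∈ S := by
        refine hd'.resolve_right ?_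
        rintro ⟨u, h1, h2, _, h4, h5⟩
        have := huniq u ((hmemX u).mpr ⟨⟨h2, h1⟩, by tauto⟩)
        exact h4 (this ▸ hvS)
      have := mul_le_mul_of_nonneg_left (hx.cut S hrS d hdS (Finset.mem_univ d)) hα
      rw [hd] at this
      linarith
    · have h3 : 3 ≤ X.card := by
        obtain ⟨k, hk⟩ := hodd
        omega
      obtain ⟨v, hvX⟩ := Finset.card_pos.mp (show 0 < X.card by omega)
      obtain ⟨⟨hvr, hvW⟩, hcr⟩ := (hmemX v).mp hvX
      obtain ⟨w, hwW, hwS⟩ : ∃ w ∈ W, w ∈ S := by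
        by_cases hvS : v ∈ S
        · exact ⟨v, hvW, hvS⟩
        · exact ⟨par v, hT.par_mem v hvW hvr, by tauto⟩
      have h4 : α * (2 * γ) ≤ α * cutVal x S := mul_le_mul_of_nonneg_left
        (le_trans (by linarith [hγ w hwW]) (hx.cut S hrS w hwS (Finset.mem_univ w))) hα
      have h5 : (X.card : ℝ) * (1 - 2 * α) ≤ ∑ v ∈ X, (1 - 2 * α * η v) := by
        rw [← nsmul_eq_mul]
        exact Finset.card_nsmul_le_sum _ _ _ fun v _ => hβ v
      have h6 : (3 : ℝ) * (1 - 2 * α) ≤ X.card * (1 - 2 * α) :=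
        mul_le_mul_of_nonneg_right (by exact_mod_cast h3) (by linarith)
      linarith
  obtain ⟨t, h1, h2, h3, h4⟩ := exists_tour_of_tree_of_join c hC hCc hC0 htri hT hzs hz0
    (fun S hS => by
      by_cases hrS : r ∈ S
      · rw [← cutVal_compl hzs]
        refine hcut0 _ (by simpa using hrS) ?_
        simpa only [Finset.mem_compl, not_iff_not] using hS
      · exact hcut0 S hrS hS)
  refine ⟨t, h1, h2, h3, h4.trans (le_of_eq ?_)⟩
  have hsum : ∑ a, ∑ b, C a b * z a b = α * ∑ a, ∑ b, C a b * x a b +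
      ∑ v ∈ W.erase r, (1 - 2 * α * η v) * (C v (par v) + C (par v) v) := by
    simp only [← sum_mul_edgeWeight C, hz, mul_add, Finset.sum_add_distrib, Finset.mul_sum]
    simp only [Finset.sum_comm (t := W.erase r)]
    congr 1
    · exact Finset.sum_congr rfl fun a _ => Finset.sum_congr rfl fun b _ => by ring
    · exact Finset.sum_congr rfl fun v _ => Finset.sum_congr rfl fun a _ =>
        Finset.sum_congr rfl fun b _ => by ring
  have hlin : ∑ v ∈ W.erase r, C v (par v) * (2 - 2 * α * η v) = ∑ v ∈ W.erase r, C v (par v) +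
      (1 / 2) * ∑ v ∈ W.erase r, (1 - 2 * α * η v) * (C v (par v) + C (par v) v) := by
    rw [Finset.mul_sum, ← Finset.sum_add_distrib]
    exact Finset.sum_congr rfl fun v _ => by rw [hC (par v) v]; ring
  rw [hsum, hlin]
  ring

end ParityCorrection

section Threshold

/-- A threshold that is as good as a uniformly random one. -/
theorem exists_threshold {ι : Type*} (s : Finset ι) (f k p : ι → ℝ)
    (hf0 : ∀ i ∈ s, 0 ≤ f i) (hf1 : ∀ i ∈ s, f i ≤ 1) :
    ∃ u : ℝ, ∑ i ∈ s, (if u ≤ f i then k i else p i)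
      ≤ ∑ i ∈ s, (f i * k i + (1 - f i) * p i) := by
  let μ : MeasureTheory.Measure ℝ := MeasureTheory.volume.restrict (Set.Ioc 0 1)
  have hμ : MeasureTheory.IsProbabilityMeasure μ := ⟨by simp [μ]⟩
  have hform : ∀ (i : ι) (u : ℝ), (if u ≤ f i then k i else p i)
      = p i + (Set.Iic (f i)).indicator (fun _ => k i - p i) u := fun i u => by
    simp only [Set.indicator_apply, Set.mem_Iic]
    split_ifs <;> ring
  have hind : ∀ i, MeasureTheory.Integrable
      ((Set.Iic (f i)).indicator (fun _ => k i - p i)) μ := fun i =>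
    (MeasureTheory.integrable_const _).indicator measurableSet_Iic
  have hfi : ∀ i, MeasureTheory.Integrable (fun u => if u ≤ f i then k i else p i) μ := fun i => by
    simp only [hform]
    exact (MeasureTheory.integrable_const _).add (hind i)
  have hval : ∀ i ∈ s, ∫ u, (if u ≤ f i then k i else p i) ∂μ = f i * k i + (1 - f i) * p i :=
    fun i hi => by
      have hset : Set.Iic (f i) ∩ Set.Ioc 0 1 = Set.Ioc 0 (f i) := by
        ext u
        simp only [Set.mem_inter_iff, Set.mem_Iic, Set.mem_Ioc]
        exact ⟨fun h => ⟨h.2.1, h.1⟩, fun h => ⟨h.2, h.1, h.2.trans (hf1 i hi)⟩⟩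
      have hμf : μ.real (Set.Iic (f i)) = f i := by
        simp [μ, MeasureTheory.measureReal_def, MeasureTheory.Measure.restrict_apply
          measurableSet_Iic, hset, hf0 i hi]
      simp only [hform]
      rw [MeasureTheory.integral_add (MeasureTheory.integrable_const _) (hind i),
        MeasureTheory.integral_indicator measurableSet_Iic, MeasureTheory.integral_const,
        MeasureTheory.probReal_univ, MeasureTheory.setIntegral_const, hμf]
      simp only [smul_eq_mul]
      ring
  obtain ⟨u, hu⟩ := MeasureTheory.exists_le_integral (μ := μ)
    (f := fun u => ∑ i ∈ s, (if u ≤ f i then k i else p i))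
    (MeasureTheory.integrable_finsetSum s fun i _ => hfi i)
  refine ⟨u, hu.trans (le_of_eq ?_)⟩
  rw [MeasureTheory.integral_finsetSum s fun i _ => hfi i]
  exact Finset.sum_congr rfl hval

end Threshold

section Pruning

/-- The probability with which a subtree with largest `y`-value `t` is kept, where `ψ` is the
inverse of the golden ratio. -/
noncomputable def keepProb (ψ t : ℝ) : ℝ := max 0 (1 + ψ - ψ / t)

variable {ψ : ℝ}

theorem keepProb_eq (h0 : 0 < ψ) (hψ : ψ ^ 2 = 1 - ψ) {t : ℝ} (ht : 1 - ψ ≤ t) :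
    keepProb ψ t = 1 + ψ - ψ / t := by
  have hp : 0 < 1 - ψ := by rw [← hψ]; positivity
  refine max_eq_right ?_
  rw [sub_nonneg, div_le_iff₀ (by linarith)]
  nlinarith

theorem keepProb_le_one (h0 : 0 < ψ) {t : ℝ} (h : 0 < t) (ht : t ≤ 1) : keepProb ψ t ≤ 1 := by
  refine max_le zero_le_one ?_
  have : ψ ≤ ψ / t := by rw [le_div_iff₀ h]; nlinarith
  linarith

theorem keepProb_mono (h0 : 0 < ψ) {s t : ℝ} (hs : 0 < s) (hst : s ≤ t) :
    keepProb ψ s ≤ keepProb ψ t := by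
  refine max_le_max le_rfl ?_
  have : ψ / t ≤ ψ / s := by gcongr
  linarith

theorem keepProb_mul_le (h0 : 0 < ψ) (hψ : ψ ^ 2 = 1 - ψ) {t : ℝ} (ht : 1 - ψ ≤ t) :
    keepProb ψ t * (2 - 2 * (1 - ψ) * t) ≤ 2 * ψ := by
  have hp : 0 < 1 - ψ := by rw [← hψ]; positivity
  have ht0 : 0 < t := by linarith
  rw [keepProb_eq h0 hψ ht, ← sub_nonneg]
  have : 2 * ψ - (1 + ψ - ψ / t) * (2 - 2 * (1 - ψ) * t) = 2 * ψ * (t - 1) ^ 2 / t := by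
    field_simp
    have h3 : ψ ^ 3 = ψ * (1 - ψ) := by rw [← hψ]; ring
    ring_nf
    nlinarith
  rw [this]
  positivity

theorem one_sub_keepProb_mul (h0 : 0 < ψ) (hψ : ψ ^ 2 = 1 - ψ) {t : ℝ} (ht : 1 - ψ ≤ t) :
    1 - keepProb ψ t * t = (1 + ψ) * (1 - t) := by
  have hp : 0 < 1 - ψ := by rw [← hψ]; positivity
  have ht0 : t ≠ 0 := by linarith
  rw [keepProb_eq h0 hψ ht]
  field_simp
  ring

end Pruning

section GoldenRatioTour

variable {V : Type*} [Fintype V] [DecidableEq V]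

theorem exists_tour_le (c : Finset V → ℝ) {C : V → V → ℝ}
    (hC : ∀ a b, C a b = C b a) (hCc : ∀ a b, a ≠ b → C a b = c {a, b}) (hC0 : ∀ a, C a a = 0)
    (hCnn : ∀ a b, 0 ≤ C a b)
    (htri : ∀ u v w, C u w ≤ C u v + C v w) {r : V} {y : V → ℝ} {x : V → V → ℝ}
    (hy : ∀ v, 0 ≤ y v) (hy1 : ∀ v, y v ≤ 1) (hyr : y r = 1)
    (hx : CutFeasible r Finset.univ y x) {p : V → ℝ} (hp : ∀ v, 0 ≤ p v) (hpr : p r = 0)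
    {ψ : ℝ} (h0 : 0 < ψ) (hψ : ψ ^ 2 = 1 - ψ) :
    ∃ t : List V, t.Nodup ∧ t.head? = some r ∧
      tourCost c t + ∑ v ∈ Finset.univ \ t.toFinset, p v ≤
        (1 + ψ) * ((1 / 2) * ∑ a, ∑ b, C a b * x a b + ∑ v, p v * (1 - y v)) := by
  set X : ℝ := (1 / 2) * ∑ a, ∑ b, C a b * x a b with hX
  have hψ1 : 0 < 1 - ψ := by rw [← hψ]; positivity
  set A : Finset V := Finset.univ.filter fun v => 1 - ψ ≤ y v with hA
  have hmemA : ∀ v, v ∈ A ↔ 1 - ψ ≤ y v := fun v => by simp [hA]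
  have hrA : r ∈ A := (hmemA r).mpr (by rw [hyr]; linarith)
  obtain ⟨x', hx', hle'⟩ := hx.exists_sdiff hy hC hC0 htri Aᶜ (by simpa using hrA)
  rw [show Finset.univ \ Aᶜ = A by ext; simp] at hx'
  obtain ⟨W, par, rk, hWA, hT, htree⟩ := exists_rootedTree hy hy1 hyr _ A rfl hrA
    (fun a b => 2 * ψ * C a b) x' (fun v => p v * keepProb ψ (y v))
    (fun a b => by rw [hC]) (fun a => by rw [hC0, mul_zero])
    (fun a _ b _ => mul_nonneg (by positivity) (hCnn a b))
    (fun a => mul_nonneg (hp a) (le_max_left _ _)) hx'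
  have hWy : ∀ v ∈ W, 1 - ψ ≤ y v := fun v hv => (hmemA v).mp (hWA hv)
  obtain ⟨η, hη1, hη2, hη3, hη4⟩ := hT.exists_subtreeMax y
  have hηle : ∀ v, η v ≤ 1 := fun v => by
    obtain ⟨d, hd⟩ := hη3 v
    exact hd ▸ hy1 d
  have hWη : ∀ v ∈ W, 1 - ψ ≤ η v := fun v hv => (hWy v hv).trans (hη1 v hv)
  obtain ⟨u, hu⟩ := exists_threshold (W.erase r) (fun v => keepProb ψ (η v))
    (fun v => C v (par v) * (2 - 2 * (1 - ψ) * η v)) p (fun v _ => le_max_left _ _)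
    (fun v hv => keepProb_le_one h0 (hψ1.trans_le (hWη v (Finset.mem_of_mem_erase hv))) (hηle v))
  set U : Finset V := W.filter fun v => v = r ∨ u ≤ keepProb ψ (η v) with hU
  have hmemU : ∀ v, v ∈ U ↔ v ∈ W ∧ (v = r ∨ u ≤ keepProb ψ (η v)) := fun v => by
    rw [hU, Finset.mem_filter]
  have hTU : IsRootedTree r U par rk := by
    refine ⟨(hmemU r).mpr ⟨hT.root_mem, Or.inl rfl⟩, fun v hv hvr => ?_,
      fun v hv hvr => hT.rk_lt v ((hmemU v).mp hv).1 hvr⟩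
    obtain ⟨hvW, h⟩ := (hmemU v).mp hv
    exact (hmemU _).mpr ⟨hT.par_mem v hvW hvr, Or.inr ((h.resolve_left hvr).trans
      (keepProb_mono h0 (hψ1.trans_le (hWη v hvW)) (hη2 v hvW hvr)))⟩
  obtain ⟨t, ht1, ht2, ht3, ht4⟩ := exists_tour_of_tree c hC hCc hC0 htri hx hTU
    (α := 1 - ψ) (γ := 1 - ψ) (η := η) hψ1.le (by nlinarith) (by nlinarith)
    (fun v hv => hWy v ((hmemU v).mp hv).1) hηle (fun v hv hvr S hvS => by
      obtain ⟨hvW, h⟩ := (hmemU v).mp hv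
      obtain ⟨d, hd, h'⟩ := hη4 v hvW S hvS
      refine ⟨d, hd, h'.imp_right ?_⟩
      rintro ⟨w, h1, h2, h3, h4⟩
      exact ⟨w, (hmemU w).mpr ⟨h1, Or.inr (h3 ▸ h.resolve_left hvr)⟩, h2, h3, h4⟩)
  refine ⟨t, ht1, ht2, ?_⟩
  have hUer : U.erase r = (W.erase r).filter fun v => u ≤ keepProb ψ (η v) := by
    ext v
    simp only [Finset.mem_erase, hmemU, Finset.mem_filter]
    tauto
  have hpen : ∑ v ∈ Finset.univ \ t.toFinset, p v ≤ ∑ v ∈ Wᶜ, p v +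
      ∑ v ∈ (W.erase r).filter (fun v => ¬ u ≤ keepProb ψ (η v)), p v := by
    rw [← Finset.sum_union]
    · refine Finset.sum_le_sum_of_subset_of_nonneg (fun v hv => ?_) fun v _ _ => hp v
      have hvU : v ∉ U := fun h => (Finset.mem_sdiff.mp hv).2 (ht3 h)
      rw [hmemU] at hvU
      simp only [Finset.mem_union, Finset.mem_compl, Finset.mem_filter, Finset.mem_erase]
      tauto
    · rw [Finset.disjoint_left]
      intro v hv hv'
      exact (Finset.mem_compl.mp hv) (Finset.mem_of_mem_erase (Finset.mem_of_mem_filter v hv'))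
  rw [Finset.sum_ite, ← hUer] at hu
  have hround : ∑ v ∈ W.erase r, (keepProb ψ (η v) * (C v (par v) * (2 - 2 * (1 - ψ) * η v)) +
      (1 - keepProb ψ (η v)) * p v) ≤
      ∑ v ∈ W.erase r, 2 * ψ * C v (par v) + ∑ v ∈ W.erase r, (p v - p v * keepProb ψ (y v)) := by
    rw [← Finset.sum_add_distrib]
    refine Finset.sum_le_sum fun v hv => add_le_add ?_ ?_
    · have hv' := Finset.mem_of_mem_erase hv
      have := mul_le_mul_of_nonneg_left (keepProb_mul_le h0 hψ (hWη v hv')) (hCnn v (par v))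
      linarith
    · have hv' := Finset.mem_of_mem_erase hv
      have := mul_le_mul_of_nonneg_left
        (keepProb_mono h0 (hψ1.trans_le (hWy v hv')) (hη1 v hv')) (hp v)
      linarith
  have hWr : ∑ v ∈ W.erase r, (p v - p v * keepProb ψ (y v)) =
      ∑ v ∈ W, (p v - p v * keepProb ψ (y v)) :=
    Finset.sum_erase _ (by rw [hpr]; ring)
  have hscale : (1 / 2) * ∑ a, ∑ b, 2 * ψ * C a b * x' a b ≤ 2 * ψ * X := by
    have : ∑ a, ∑ b, 2 * ψ * C a b * x' a b = 2 * ψ * ∑ a, ∑ b, C a b * x' a b := by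
      simp only [Finset.mul_sum, mul_assoc]
    rw [this, hX]
    nlinarith
  have hfinal : ∑ v ∈ Wᶜ, p v + ∑ v ∈ W, (p v - p v * keepProb ψ (y v)) +
      ∑ v ∈ A, p v * keepProb ψ (y v) * (1 - y v) - ∑ v ∈ A \ W, p v * keepProb ψ (y v)
      ≤ (1 + ψ) * ∑ v, p v * (1 - y v) := by
    have e1 : ∑ v ∈ A, p v * keepProb ψ (y v) =
        ∑ v ∈ A \ W, p v * keepProb ψ (y v) + ∑ v ∈ W, p v * keepProb ψ (y v) :=
      (Finset.sum_sdiff hWA).symm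
    have e2 : ∑ v, p v = ∑ v ∈ Wᶜ, p v + ∑ v ∈ W, p v := (Finset.sum_compl_add_sum W p).symm
    have e3 : ∑ v, p v = ∑ v ∈ Aᶜ, p v + ∑ v ∈ A, p v := (Finset.sum_compl_add_sum A p).symm
    have e4 : (1 + ψ) * ∑ v, p v * (1 - y v) = ∑ v ∈ Aᶜ, (1 + ψ) * (p v * (1 - y v)) +
        ∑ v ∈ A, (1 + ψ) * (p v * (1 - y v)) := by
      rw [Finset.mul_sum]; exact (Finset.sum_compl_add_sum A _).symm
    have e5 : ∑ v ∈ Aᶜ, p v ≤ ∑ v ∈ Aᶜ, (1 + ψ) * (p v * (1 - y v)) :=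
      Finset.sum_le_sum fun v hv => by
        have h1 : y v ≤ 1 - ψ := by
          rw [Finset.mem_compl, hmemA] at hv
          exact (not_le.mp hv).le
        have h2 : 1 ≤ (1 + ψ) * (1 - y v) := by nlinarith
        nlinarith [hp v]
    have e6 : ∑ v ∈ A, (1 + ψ) * (p v * (1 - y v)) = ∑ v ∈ A, p v -
        ∑ v ∈ A, p v * keepProb ψ (y v) + ∑ v ∈ A, p v * keepProb ψ (y v) * (1 - y v) := by
      rw [← Finset.sum_sub_distrib, ← Finset.sum_add_distrib]
      refine Finset.sum_congr rfl fun v hv => ?_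
      have := one_sub_keepProb_mul h0 hψ ((hmemA v).mp hv)
      linear_combination (-p v) * this
    rw [Finset.sum_sub_distrib]
    linarith
  rw [hWr] at hround
  rw [← hX] at ht4
  rw [Finset.sum_add_distrib] at hround hu
  linarith

end GoldenRatioTour

section LPTranslation

variable {V : Type*} [Fintype V] [DecidableEq V]

/-- The extension of an edge function to ordered pairs, vanishing on the diagonal. -/
def pairFun (g : Finset V → ℝ) (a b : V) : ℝ := if a = b then 0 else g {a, b}

theorem pairFun_symm (g : Finset V → ℝ) (a b : V) : pairFun g a b = pairFun g b a := by
  unfold pairFun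
  rw [Finset.pair_comm]
  by_cases h : a = b
  · rw [h]
  · rw [if_neg h, if_neg (Ne.symm h)]

theorem pair_mem_completeEdges {a b : V} (h : a ≠ b) : {a, b} ∈ completeEdges V := by
  rw [completeEdges, Finset.mem_powersetCard]
  exact ⟨Finset.subset_univ _, Finset.card_pair h⟩

theorem sum_completeEdges (g : Finset V → ℝ) :
    ∑ e ∈ completeEdges V, g e = (1 / 2) * ∑ a, ∑ b, pairFun g a b := by
  have himg : completeEdges V = (Finset.univ : Finset V).offDiag.image fun q => {q.1, q.2} := by
    ext e
    simp only [Finset.mem_image, Finset.mem_offDiag, Finset.mem_univ, true_and, Prod.exists]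
    constructor
    · intro he
      obtain ⟨a, b, hab, rfl⟩ := Finset.card_eq_two.mp (Finset.mem_powersetCard.mp he).2
      exact ⟨a, b, hab, rfl⟩
    · rintro ⟨a, b, hab, rfl⟩
      exact pair_mem_completeEdges hab
  have h1 : ∑ q ∈ (Finset.univ : Finset V).offDiag, g {q.1, q.2} =
      ∑ e ∈ completeEdges V, 2 * g e := by
    rw [Finset.sum_comp g fun q : V × V => ({q.1, q.2} : Finset V), ← himg]
    refine Finset.sum_congr rfl fun e he => ?_
    obtain ⟨a, b, hab, rfl⟩ := Finset.card_eq_two.mp (Finset.mem_powersetCard.mp he).2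
    have : (Finset.univ : Finset V).offDiag.filter
        (fun q => ({q.1, q.2} : Finset V) = {a, b}) = {(a, b), (b, a)} := by
      ext ⟨u, w⟩
      simp only [Finset.mem_filter, Finset.mem_offDiag, Finset.mem_univ, true_and,
        Finset.mem_insert, Finset.mem_singleton, Prod.mk.injEq]
      rw [← Finset.coe_inj, Finset.coe_pair, Finset.coe_pair, Set.pair_eq_pair_iff]
      constructor
      · exact fun h => h.2
      · rintro (⟨rfl, rfl⟩ | ⟨rfl, rfl⟩)
        · exact ⟨hab, Or.inl ⟨rfl, rfl⟩⟩
        · exact ⟨hab.symm, Or.inr ⟨rfl, rfl⟩⟩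
    rw [this, Finset.card_pair (by simp [hab]), nsmul_eq_mul]
    norm_num
  have h2 : ∑ a, ∑ b, pairFun g a b = ∑ q ∈ (Finset.univ : Finset V).offDiag, g {q.1, q.2} := by
    rw [← Finset.sum_product', Finset.univ_product_univ]
    have : (Finset.univ : Finset V).offDiag = Finset.univ.filter fun q : V × V => q.1 ≠ q.2 := by
      ext; simp
    rw [this, Finset.sum_filter]
    refine Finset.sum_congr rfl fun q _ => ?_
    unfold pairFun
    split_ifs <;> simp_all
  rw [h2, h1, ← Finset.mul_sum]
  ring

theorem sum_cutEdges (g : Finset V → ℝ) (S : Finset V) :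
    ∑ e ∈ cutEdges V S, g e = cutVal (pairFun g) S := by
  have hcard : ∀ a b : V, a ≠ b → ((({a, b} : Finset V) ∩ S).card = 1 ↔ ¬(a ∈ S ↔ b ∈ S)) :=
    fun a b hab => by
      by_cases h1 : a ∈ S <;> by_cases h2 : b ∈ S <;>
        simp [Finset.insert_inter_of_mem, Finset.insert_inter_of_notMem,
          Finset.singleton_inter_of_mem, Finset.singleton_inter_of_notMem, h1, h2, hab]
  have h1 := two_mul_cutVal (pairFun_symm g) S
  have h2 := sum_completeEdges fun e => if (e ∩ S).card = 1 then g e else 0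
  rw [cutEdges, Finset.sum_filter, h2]
  have h3 : ∀ a b, pairFun (fun e => if (e ∩ S).card = 1 then g e else 0) a b =
      if (a ∈ S ↔ b ∈ S) then 0 else pairFun g a b := fun a b => by
    unfold pairFun
    by_cases hab : a = b
    · simp [hab]
    · rw [if_neg hab, if_neg hab]
      simp only [hcard a b hab]
      by_cases h : (a ∈ S ↔ b ∈ S) <;> simp [h]
  simp only [h3]
  linarith

theorem IsFeasibleLP.cutFeasible {r : V} {x : Finset V → ℝ} {y : V → ℝ} (h : IsFeasibleLP r x y) :
    CutFeasible r Finset.univ y (pairFun x) := by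
  obtain ⟨h1, -, -, -, -, h6⟩ := h
  refine ⟨pairFun_symm x, fun a b => ?_, fun a ha => absurd (Finset.mem_univ a) ha,
    fun S hS u hu _ => ?_⟩
  · unfold pairFun
    split_ifs with hab
    · exact le_rfl
    · exact h1 _ (pair_mem_completeEdges hab)
  · rw [← sum_cutEdges]
    exact h6 S hS u hu

theorem IsFeasibleLP.le_one {r : V} {x : Finset V → ℝ} {y : V → ℝ} (h : IsFeasibleLP r x y)
    (v : V) : y v ≤ 1 := by
  obtain ⟨-, -, h3, -, h5, h6⟩ := h
  by_cases hv : v = r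
  · rw [hv, h3]
  · have := h6 {r}ᶜ (by simp) v (by simpa using hv)
    rw [sum_cutEdges, cutVal_compl (pairFun_symm x), ← sum_cutEdges] at this
    linarith

end LPTranslation

/-- the integrality gap of the PCTSP LP relaxation is at most the golden
ratio `(1 + √5)/2`. -/
theorem pctsp_gap_le_goldenRatio (V : Type*) [Fintype V] [DecidableEq V]
    (hV : 2 ≤ Fintype.card V) (r : V)
    (c : Finset V → ℝ) (π : V → ℝ)
    (hc : ∀ e ∈ completeEdges V, 0 ≤ c e)
    (htri : ∀ u v w : V, u ≠ v → v ≠ w → u ≠ w → c {u, w} ≤ c {u, v} + c {v, w})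
    (hπ : ∀ v : V, 0 ≤ π v) (hπr : π r = 0)
    (x : Finset V → ℝ) (y : V → ℝ) (hxy : IsFeasibleLP r x y) :
    ∃ t : List V, t.Nodup ∧ t.head? = some r ∧
      tourCost c t + ∑ v ∈ Finset.univ \ t.toFinset, π v ≤
        ((1 + Real.sqrt 5) / 2) *
          (∑ e ∈ completeEdges V, c e * x e + ∑ v : V, π v * (1 - y v)) := by
  have hnn : ∀ a b, 0 ≤ pairFun c a b := fun a b => by
    unfold pairFun
    split_ifs with hab
    · exact le_rfl
    · exact hc _ (pair_mem_completeEdges hab)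
  have htri' : ∀ u v w, pairFun c u w ≤ pairFun c u v + pairFun c v w := fun u v w => by
    by_cases huw : u = w
    · rw [pairFun, if_pos huw]
      exact add_nonneg (hnn _ _) (hnn _ _)
    by_cases huv : u = v
    · rw [huv]
      linarith [hnn v v]
    by_cases hvw : v = w
    · rw [hvw]
      linarith [hnn w w]
    simpa only [pairFun, if_neg huw, if_neg huv, if_neg hvw] using htri u v w huv hvw huw
  have h5 : Real.sqrt 5 ^ 2 = 5 := Real.sq_sqrt (by norm_num)
  have h5' : 1 < Real.sqrt 5 := Real.lt_sqrt_of_sq_lt (by norm_num)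
  obtain ⟨t, h1, h2, h3⟩ := exists_tour_le c (pairFun_symm c)
    (fun a b hab => by rw [pairFun, if_neg hab]) (fun a => by rw [pairFun, if_pos rfl]) hnn htri'
    hxy.2.1 hxy.le_one hxy.2.2.1 hxy.cutFeasible hπ hπr (ψ := (Real.sqrt 5 - 1) / 2)
    (by linarith) (by nlinarith)
  refine ⟨t, h1, h2, h3.trans (le_of_eq ?_)⟩
  have hmul : ∀ a b, pairFun c a b * pairFun x a b = pairFun (fun e => c e * x e) a b :=
    fun a b => by unfold pairFun; split_ifs <;> simp
  simp only [hmul]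
  rw [← sum_completeEdges]
  ring
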